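/- arXiv:1402.0684 — 5 statements merged into one kernel-verified Lean document; each statement's English description precedes it below -/
import Mathlib

section
/- For every real X > 1 and every real s with 0 < s < 2, one has ∫₀^X ψ(v)·v^{-s/2} dv = ζ(s/2 − 1)/(s/2 − 1) + O(X^{-s/2}), where ζ is the Riemann zeta function (its analytic continuation, since s/2 − 1 < 0) and the implied constant is absolute. -/
open scoped BigOperators

/-- The sawtooth function `ψ(v) = ⌊v⌋ − v + 1/2`. -/
noncomputable def saw (v : ℝ) : ℝ := (⌊v⌋ : ℝ) - v + 1 / 2

open MeasureTheory Set Filter Topology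

noncomputable def sawP (x : ℝ) : ℝ := (Int.fract x - Int.fract x ^ 2) / 2

lemma saw_eq (x : ℝ) : saw x = 1 / 2 - Int.fract x := by
  unfold saw; rw [Int.fract]; ring

lemma saw_meas : Measurable saw := by
  have : saw = fun x => 1 / 2 - Int.fract x := funext saw_eq
  rw [this]; fun_prop

lemma saw_bdd (x : ℝ) : |saw x| ≤ 1 := by
  rw [saw_eq, abs_le]
  constructor <;> linarith [Int.fract_nonneg x, Int.fract_lt_one x]

lemma sawP_nonneg (x : ℝ) : 0 ≤ sawP x := by
  unfold sawP
  nlinarith [Int.fract_nonneg x, Int.fract_lt_one x]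

lemma sawP_le (x : ℝ) : sawP x ≤ 1 / 2 := by
  unfold sawP
  nlinarith [Int.fract_nonneg x, Int.fract_lt_one x]

lemma sawP_bdd (x : ℝ) : |sawP x| ≤ 1 := by
  rw [abs_of_nonneg (sawP_nonneg x)]; linarith [sawP_le x]

lemma sawP_cont : Continuous sawP := by
  have := ContinuousOn.comp_fract'' (α := ℝ) (f := fun y : ℝ => (y - y ^ 2) / 2)
    (by fun_prop) (by norm_num)
  exact this

lemma sawP_one : sawP 1 = 0 := by simp [sawP]

lemma sawP_deriv (x : ℝ) : HasDerivWithinAt sawP (saw x) (Ioi x) x := by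
  have h : HasDerivAt (fun y : ℝ => ((y - ⌊x⌋) - (y - ⌊x⌋) ^ 2) / 2) (saw x) x := by
    have h1 : HasDerivAt (fun y : ℝ => y - (⌊x⌋ : ℝ)) 1 x := (hasDerivAt_id x).sub_const _
    refine ((h1.sub (h1.pow 2)).div_const 2).congr_deriv ?_
    unfold saw; push_cast; ring
  refine h.hasDerivWithinAt.congr_of_eventuallyEq ?_ ?_
  · have : Ioo x (⌊x⌋ + 1 : ℝ) ∈ 𝓝[>] x := Ioo_mem_nhdsGT (Int.lt_floor_add_one x)
    filter_upwards [this] with y hy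
    have : ⌊y⌋ = ⌊x⌋ := by
      rw [Int.floor_eq_iff]
      exact ⟨(Int.floor_le x).trans hy.1.le, hy.2⟩
    simp only [sawP, Int.fract, this]
  · simp only [sawP, Int.fract]

lemma intble (f : ℝ → ℝ) (hf : Measurable f) (hb : ∀ x, |f x| ≤ 1) (w : ℂ) (hw : w.re < -1)
    {c : ℝ} (hc : 0 < c) :
    IntegrableOn (fun t : ℝ => (f t : ℂ) * (t : ℂ) ^ w) (Ioi c) := by
  refine Integrable.bdd_mul (c := 1) (integrableOn_Ioi_cpow_of_lt hw hc) ?_ ?_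
  · exact (Complex.measurable_ofReal.comp hf).aestronglyMeasurable
  · exact Eventually.of_forall fun x => by simpa using hb x

lemma intble' (f : ℝ → ℝ) (hf : Measurable f) (hb : ∀ x, |f x| ≤ 1) (w : ℂ)
    {X : ℝ} (hX : 1 ≤ X) :
    IntervalIntegrable (fun t : ℝ => (f t : ℂ) * (t : ℂ) ^ w) volume 1 X := by
  rw [intervalIntegrable_iff_integrableOn_Icc_of_le hX]
  refine Integrable.bdd_mul (c := 1) ?_ ?_ ?_
  · refine ContinuousOn.integrableOn_Icc fun t ht => ?_
    exact (Complex.continuousAt_ofReal_cpow_const _ _ <|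
      Or.inr (zero_lt_one.trans_le ht.1).ne').continuousWithinAt
  · exact (Complex.measurable_ofReal.comp hf).aestronglyMeasurable
  · exact Eventually.of_forall fun x => by simpa using hb x

lemma ibp (w : ℂ) {X : ℝ} (hX : 1 ≤ X) :
    ∫ t in (1 : ℝ)..X, (saw t : ℂ) * (t : ℂ) ^ w =
      (sawP X : ℂ) * (X : ℂ) ^ w - w * ∫ t in (1 : ℝ)..X, (sawP t : ℂ) * (t : ℂ) ^ (w - 1) := by
  have i1 := intble' saw saw_meas saw_bdd w hX
  have i2 := intble' sawP sawP_cont.measurable sawP_bdd (w - 1) hX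
  have key := intervalIntegral.integral_eq_sub_of_hasDeriv_right_of_le hX
    (f := fun t : ℝ => (sawP t : ℂ) * (t : ℂ) ^ w)
    (f' := fun t : ℝ => (saw t : ℂ) * (t : ℂ) ^ w + w * ((sawP t : ℂ) * (t : ℂ) ^ (w - 1)))
    ?_ ?_ (i1.add (i2.const_mul w))
  · rw [intervalIntegral.integral_add i1 (i2.const_mul w),
      intervalIntegral.integral_const_mul, sawP_one] at key
    simp only [Complex.ofReal_zero, zero_mul, sub_zero] at key
    rw [← key]; ring
  · intro t ht
    refine ContinuousAt.continuousWithinAt (ContinuousAt.mul ?_ ?_)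
    · exact (Complex.continuous_ofReal.comp sawP_cont).continuousAt
    · exact Complex.continuousAt_ofReal_cpow_const _ _ (Or.inr (zero_lt_one.trans_le ht.1).ne')
  · intro t ht
    have ht0 : t ≠ 0 := (zero_lt_one.trans ht.1).ne'
    have h1 : HasDerivWithinAt (fun t : ℝ => (sawP t : ℂ)) (saw t : ℂ) (Ioi t) t :=
      (sawP_deriv t).ofReal_comp
    have h2 : HasDerivAt (fun t : ℝ => (t : ℂ) ^ w) (w * (t : ℂ) ^ (w - 1)) t := by
      have h3 : HasDerivAt (fun z : ℂ => z ^ w) (w * (t : ℂ) ^ (w - 1)) (t : ℂ) := by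
        have := (hasDerivAt_id (t : ℂ)).cpow_const (c := w)
          (Complex.ofReal_mem_slitPlane.2 (zero_lt_one.trans ht.1))
        simpa using this
      exact h3.comp_ofReal
    refine (h1.mul h2.hasDerivWithinAt).congr_deriv ?_
    ring

noncomputable def gI (w : ℂ) : ℂ := ∫ t in Ioi (1 : ℝ), (sawP t : ℂ) * (t : ℂ) ^ (-w - 2)

lemma gI_diff {w : ℂ} (hw : -1 < w.re) : DifferentiableAt ℂ gI w := by
  have e : gI = fun w => mellin (indicator (Ioi 1) fun t : ℝ => (sawP t : ℂ)) (-w - 1) := by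
    funext w
    unfold gI mellin
    have : ∀ t : ℝ, (t : ℂ) ^ (-w - 1 - 1) • (indicator (Ioi 1) fun t : ℝ => (sawP t : ℂ)) t
        = indicator (Ioi 1) (fun t : ℝ => (sawP t : ℂ) * (t : ℂ) ^ (-w - 2)) t := by
      intro t
      by_cases h : t ∈ Ioi (1 : ℝ)
      · rw [indicator_of_mem h, indicator_of_mem h, smul_eq_mul, mul_comm]; ring_nf
      · rw [indicator_of_notMem h, indicator_of_notMem h, smul_zero]
    simp_rw [this]
    rw [setIntegral_indicator measurableSet_Ioi]
    congr 2
    ext t; simp only [mem_Ioi, mem_inter_iff]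
    exact ⟨fun h => ⟨by linarith, h⟩, fun h => h.2⟩
  rw [e]
  have hm : LocallyIntegrable (indicator (Ioi 1) fun t : ℝ => (sawP t : ℂ)) :=
    (Complex.continuous_ofReal.comp sawP_cont).locallyIntegrable.indicator measurableSet_Ioi
  have := mellin_differentiableAt_of_isBigO_rpow (a := 0) (b := -w.re - 2) (s := -w - 1)
    (f := indicator (Ioi 1) fun t : ℝ => (sawP t : ℂ)) (hm.locallyIntegrableOn _) ?_ ?_ ?_ ?_
  · exact DifferentiableAt.comp (g := mellin (indicator (Ioi 1) fun t : ℝ => (sawP t : ℂ)))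
      (f := fun w => -w - 1) w this (by fun_prop)
  · refine Asymptotics.IsBigO.of_bound 1 (Eventually.of_forall fun t => ?_)
    simp only [neg_zero, Real.rpow_zero, norm_one, mul_one]
    refine (norm_indicator_le_norm_self _ _).trans ?_
    simpa using sawP_bdd t
  · simp; linarith
  · refine Asymptotics.IsBigO.of_bound 1 ?_
    have : Ioo (0 : ℝ) 1 ∈ 𝓝[>] (0 : ℝ) := Ioo_mem_nhdsGT zero_lt_one
    filter_upwards [this] with t ht
    rw [indicator_of_notMem (by simpa using ht.2.le)]
    simp
  · simp

lemma saw_int {w : ℂ} (hw : 1 < w.re) :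
    ∫ t in Ioi (1 : ℝ), (saw t : ℂ) * (t : ℂ) ^ (-w - 1) = (w + 1) * gI w := by
  have l1 := intervalIntegral_tendsto_integral_Ioi 1
    (intble saw saw_meas saw_bdd (-w - 1) (by simp; linarith) one_pos) tendsto_id
  have l2 := intervalIntegral_tendsto_integral_Ioi 1
    (intble sawP sawP_cont.measurable sawP_bdd (-w - 2) (by simp; linarith) one_pos) tendsto_id
  have l3 : Tendsto (fun X : ℝ => (sawP X : ℂ) * (X : ℂ) ^ (-w - 1)) atTop (𝓝 0) := by
    have h0 : Tendsto (fun X : ℝ => X ^ (-(w.re + 1))) atTop (𝓝 0) :=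
      tendsto_rpow_neg_atTop (by linarith)
    refine squeeze_zero_norm' ?_ h0
    filter_upwards [eventually_gt_atTop 0] with X hX
    rw [norm_mul, Complex.norm_cpow_eq_rpow_re_of_pos hX]
    have : (-w - 1).re = -(w.re + 1) := by simp; ring
    rw [this]
    have h1 : ‖(sawP X : ℂ)‖ ≤ 1 := by simpa using sawP_bdd X
    have := Real.rpow_nonneg hX.le (-(w.re + 1))
    nlinarith
  refine tendsto_nhds_unique l1 ?_
  have l4 := l3.sub (l2.const_mul (-w - 1))
  have : (0 : ℂ) - (-w - 1) * ∫ t in Ioi (1 : ℝ), (sawP t : ℂ) * (t : ℂ) ^ (-w - 2)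
      = (w + 1) * gI w := by unfold gI; ring
  rw [this] at l4
  refine l4.congr' ?_
  filter_upwards [eventually_ge_atTop 1] with X hX
  have := ibp (-w - 1) hX
  rw [show -w - 1 - 1 = -w - 2 by ring] at this
  exact this.symm

lemma zeta_big {w : ℂ} (hw : 1 < w.re) :
    riemannZeta w = 1 / (w - 1) + 1 / 2 + w * (w + 1) * gI w := by
  have hw0 : w ≠ 0 := by rintro rfl; simp at hw; linarith
  have hw1 : w - 1 ≠ 0 := by
    intro h; rw [sub_eq_zero] at h; rw [h] at hw; simp at hw
  have h := LSeries_eq_mul_integral' (1 : ℕ → ℂ) zero_le_one hw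
    (by
      refine Asymptotics.IsBigO.of_bound 1 (Eventually.of_forall fun n => ?_)
      simp)
  rw [LSeries_one_eq_riemannZeta hw] at h
  rw [h]
  have i1 := intble saw saw_meas saw_bdd (-w - 1) (by simp; linarith) one_pos
  have i2 : IntegrableOn (fun t : ℝ => (t : ℂ) ^ (-w)) (Ioi 1) :=
    integrableOn_Ioi_cpow_of_lt (by simpa using hw) one_pos
  have i3 : IntegrableOn (fun t : ℝ => (t : ℂ) ^ (-w - 1)) (Ioi 1) :=
    integrableOn_Ioi_cpow_of_lt (by simp; linarith) one_pos
  have e : ∫ t in Ioi (1 : ℝ), (∑ k ∈ Finset.Icc 1 ⌊t⌋₊, (1 : ℕ → ℂ) k) * (t : ℂ) ^ (-(w + 1))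
      = ∫ t in Ioi (1 : ℝ), (((saw t : ℂ) * (t : ℂ) ^ (-w - 1) + (t : ℂ) ^ (-w))
        - 1 / 2 * (t : ℂ) ^ (-w - 1)) := by
    refine setIntegral_congr_fun measurableSet_Ioi fun t ht => ?_
    have ht' : (1 : ℝ) < t := ht
    have ht0 : (t : ℂ) ≠ 0 := by
      exact_mod_cast (by linarith : t ≠ 0)
    have hfl : ((⌊t⌋₊ : ℕ) : ℂ) = ((⌊t⌋ : ℤ) : ℂ) := by
      rw [← Int.natCast_floor_eq_floor (by linarith : (0 : ℝ) ≤ t)]; simp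
    have hp : (t : ℂ) ^ (-w) = t * (t : ℂ) ^ (-w - 1) := by
      rw [Complex.cpow_sub _ _ ht0, Complex.cpow_one]; field_simp
    simp only [Pi.one_apply, Finset.sum_const, Nat.card_Icc, add_tsub_cancel_right, nsmul_eq_mul,
      mul_one]
    rw [hfl, hp, show -(w + 1) = -w - 1 by ring, saw]
    push_cast
    ring
  have e2 : ∫ t in Ioi (1 : ℝ), (t : ℂ) ^ (-w) = 1 / (w - 1) := by
    rw [integral_Ioi_cpow_of_lt (by simpa using hw) one_pos]
    rw [Complex.ofReal_one, Complex.one_cpow, show -w + 1 = -(w - 1) by ring, neg_div_neg_eq]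
  have e3 : ∫ t in Ioi (1 : ℝ), (t : ℂ) ^ (-w - 1) = 1 / w := by
    rw [integral_Ioi_cpow_of_lt (by simp; linarith) one_pos]
    rw [Complex.ofReal_one, Complex.one_cpow, show -w - 1 + 1 = -w by ring, neg_div_neg_eq]
  have i12 : IntegrableOn (fun t : ℝ => (saw t : ℂ) * (t : ℂ) ^ (-w - 1) + (t : ℂ) ^ (-w))
    (Ioi 1) := i1.add i2
  rw [e, integral_sub i12 (i3.const_mul _), integral_add i1 i2, integral_const_mul, e2, e3,
    saw_int hw]
  field_simp
  ring

lemma zeta_cont {w : ℂ} (hw : -1 < w.re) (h1 : w ≠ 1) :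
    riemannZeta w = 1 / (w - 1) + 1 / 2 + w * (w + 1) * gI w := by
  have hU : IsOpen {w : ℂ | -1 < w.re} := isOpen_lt continuous_const Complex.continuous_re
  have key : EqOn riemannZeta₁ (fun w => 1 + (w - 1) / 2 + (w - 1) * (w * (w + 1) * gI w))
      {w : ℂ | -1 < w.re} := by
    refine AnalyticOnNhd.eqOn_of_preconnected_of_eventuallyEq (𝕜 := ℂ) (z₀ := 2) ?_ ?_ ?_ ?_ ?_
    · exact (differentiable_riemannZeta₁.differentiableOn).analyticOnNhd hU
    · refine DifferentiableOn.analyticOnNhd (fun z hz => ?_) hU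
      have := gI_diff (w := z) hz
      exact DifferentiableAt.differentiableWithinAt (by fun_prop)
    · exact (convex_halfSpace_re_gt (-1)).isPreconnected
    · simp; norm_num
    · have : {w : ℂ | 1 < w.re} ∈ 𝓝 (2 : ℂ) :=
        (isOpen_lt continuous_const Complex.continuous_re).mem_nhds (by simp)
      filter_upwards [this] with z hz
      have hz1 : z ≠ 1 := by rintro rfl; simp at hz
      have a := zeta_big hz
      have b := riemannZeta_eq_inv_sub_mul hz1
      have := sub_ne_zero.2 hz1
      rw [b] at a
      field_simp at a ⊢
      linear_combination a
  rw [riemannZeta_eq_inv_sub_mul h1, key hw]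
  have := sub_ne_zero.2 h1
  field_simp

lemma int01 {a : ℝ} (h1 : a < 1) :
    IntervalIntegrable (fun v => saw v * v ^ (-a)) volume 0 1 ∧
    ∫ v in (0 : ℝ)..1, saw v * v ^ (-a) = 1 / (2 * (1 - a)) - 1 / (2 - a) := by
  have i1 : IntervalIntegrable (fun v : ℝ => v ^ (-a)) volume 0 1 :=
    intervalIntegral.intervalIntegrable_rpow' (by linarith)
  have i2 : IntervalIntegrable (fun v : ℝ => v ^ (1 - a)) volume 0 1 :=
    intervalIntegral.intervalIntegrable_rpow' (by linarith)
  have hc : ∀ᵐ v : ℝ, v ∈ uIoc (0 : ℝ) 1 → 1 / 2 * v ^ (-a) - v ^ (1 - a) = saw v * v ^ (-a) := by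
    have : ∀ᵐ v : ℝ, v ≠ 1 := by simp [ae_iff]
    filter_upwards [this] with v hv hm
    rw [uIoc_of_le zero_le_one] at hm
    have hf : ⌊v⌋ = 0 := by
      rw [Int.floor_eq_iff]; simp; exact ⟨hm.1.le, lt_of_le_of_ne hm.2 hv⟩
    rw [saw, hf, sub_eq_add_neg 1 a, Real.rpow_add hm.1, Real.rpow_one]
    push_cast; ring
  constructor
  · refine ((i1.const_mul (1 / 2)).sub i2).congr_ae ?_
    rw [EventuallyEq, ae_restrict_iff' measurableSet_uIoc]
    exact hc
  · rw [← intervalIntegral.integral_congr_ae hc, intervalIntegral.integral_sub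
      (i1.const_mul (1 / 2)) i2, intervalIntegral.integral_const_mul,
      integral_rpow (Or.inl (by linarith)), integral_rpow (Or.inl (by linarith))]
    rw [Real.zero_rpow (by linarith), Real.zero_rpow (by linarith), Real.one_rpow, Real.one_rpow]
    have : 1 - a ≠ 0 := by linarith
    have : -a + 1 ≠ 0 := by linarith
    have : 2 - a ≠ 0 := by linarith
    have : 1 - a + 1 ≠ 0 := by linarith
    rw [show 1 - a + 1 = 2 - a by ring, show -a + 1 = 1 - a by ring]
    field_simp
    ring

lemma cast_rpow (f : ℝ → ℝ) (b : ℝ) {t : ℝ} (ht : 0 ≤ t) :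
    (f t : ℂ) * (t : ℂ) ^ (b : ℂ) = ((f t * t ^ b : ℝ) : ℂ) := by
  rw [Complex.ofReal_mul, Complex.ofReal_cpow ht]

lemma ibp_real (b : ℝ) {X : ℝ} (hX : 1 ≤ X) :
    IntervalIntegrable (fun t => saw t * t ^ b) volume 1 X ∧
    ∫ t in (1 : ℝ)..X, saw t * t ^ b =
      sawP X * X ^ b - b * ∫ t in (1 : ℝ)..X, sawP t * t ^ (b - 1) := by
  have hpos : ∀ t ∈ uIcc 1 X, 0 ≤ t := by
    intro t ht; rw [uIcc_of_le hX] at ht; linarith [ht.1]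
  constructor
  · have h := (intble' saw saw_meas saw_bdd (b : ℂ) hX)
    have h2 : IntervalIntegrable (fun t => ((saw t : ℂ) * (t : ℂ) ^ (b : ℂ)).re) volume 1 X :=
      ⟨h.1.re, h.2.re⟩
    refine h2.congr fun t ht => ?_
    beta_reduce
    rw [cast_rpow _ _ (hpos t (uIoc_subset_uIcc ht)), Complex.ofReal_re]
  · have h := ibp (b : ℂ) hX
    have c1 : ∫ t in (1 : ℝ)..X, (saw t : ℂ) * (t : ℂ) ^ (b : ℂ)
        = ∫ t in (1 : ℝ)..X, ((saw t * t ^ b : ℝ) : ℂ) :=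
      intervalIntegral.integral_congr (fun t ht => cast_rpow _ _ (hpos t ht))
    have c2 : ∫ t in (1 : ℝ)..X, (sawP t : ℂ) * (t : ℂ) ^ ((b : ℂ) - 1)
        = ∫ t in (1 : ℝ)..X, ((sawP t * t ^ (b - 1) : ℝ) : ℂ) :=
      intervalIntegral.integral_congr (fun t ht => by
        have := cast_rpow sawP (b - 1) (hpos t ht)
        push_cast at this ⊢; exact this)
    rw [c1, c2,
      intervalIntegral.integral_ofReal, intervalIntegral.integral_ofReal,
      cast_rpow _ _ (by linarith)] at h
    exact_mod_cast h

lemma intP {a : ℝ} (h0 : 0 < a) {c : ℝ} (hc : 0 < c) :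
    IntegrableOn (fun t => sawP t * t ^ (-a - 1)) (Ioi c) := by
  refine Integrable.bdd_mul (c := 1) (integrableOn_Ioi_rpow_of_lt (by linarith) hc) ?_ ?_
  · exact sawP_cont.aestronglyMeasurable
  · exact Eventually.of_forall fun x => by simpa using sawP_bdd x

lemma gI_real (a : ℝ) :
    gI ((a - 1 : ℝ) : ℂ) = ((∫ t in Ioi (1 : ℝ), sawP t * t ^ (-a - 1) : ℝ) : ℂ) := by
  unfold gI
  rw [← integral_complex_ofReal]
  refine setIntegral_congr_fun measurableSet_Ioi fun t ht => ?_
  have ht' : (1 : ℝ) < t := ht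
  have := cast_rpow sawP (-a - 1) (by linarith : 0 ≤ t)
  rw [← this]
  congr 2
  push_cast; ring

theorem statement5 :
    ∃ A : ℝ, 0 < A ∧ ∀ X s : ℝ, 1 < X → 0 < s → s < 2 →
      |(∫ v in (0 : ℝ)..X, saw v * v ^ (-(s / 2)))
          - (riemannZeta (((s / 2 - 1 : ℝ) : ℂ))).re / (s / 2 - 1)|
        ≤ A * X ^ (-(s / 2)) := by
  refine ⟨1, one_pos, fun X s hX hs0 hs2 => ?_⟩
  obtain ⟨a, rfl⟩ : ∃ a, s = 2 * a := ⟨s / 2, by ring⟩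
  rw [show 2 * a / 2 = a by ring]
  have ha0 : 0 < a := by linarith
  have ha1 : a < 1 := by linarith
  have hX0 : 0 < X := by linarith
  set J := ∫ t in Ioi (1 : ℝ), sawP t * t ^ (-a - 1) with hJ
  have hz : (riemannZeta ((a - 1 : ℝ) : ℂ)).re = 1 / (a - 2) + 1 / 2 + (a - 1) * a * J := by
    have h := zeta_cont (w := ((a - 1 : ℝ) : ℂ)) (by simp; linarith)
      (by
        intro h
        have : a - 1 = 1 := by exact_mod_cast h
        linarith)
    rw [gI_real, ← hJ] at h
    have h2 : riemannZeta ((a - 1 : ℝ) : ℂ)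
        = ((1 / (a - 2) + 1 / 2 + (a - 1) * a * J : ℝ) : ℂ) := by
      rw [h]; push_cast; ring_nf
    rw [h2, Complex.ofReal_re]
  obtain ⟨i1, e1⟩ := int01 ha1
  obtain ⟨i2, e2⟩ := ibp_real (-a) hX.le
  rw [← intervalIntegral.integral_add_adjacent_intervals i1 i2, e1, e2, hz]
  have hJs : J = (∫ t in (1 : ℝ)..X, sawP t * t ^ (-a - 1))
      + ∫ t in Ioi X, sawP t * t ^ (-a - 1) := by
    rw [hJ, intervalIntegral.integral_of_le hX.le, ← setIntegral_union
      (Ioc_disjoint_Ioi le_rfl) measurableSet_Ioi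
      ((intP ha0 one_pos).mono_set Ioc_subset_Ioi_self) (intP ha0 hX0), Ioc_union_Ioi_eq_Ioi hX.le]
  set T := ∫ t in Ioi X, sawP t * t ^ (-a - 1) with hT
  have hT0 : 0 ≤ T := setIntegral_nonneg measurableSet_Ioi fun t ht =>
    mul_nonneg (sawP_nonneg t) (Real.rpow_nonneg (hX0.trans ht).le _)
  have hT1 : a * T ≤ X ^ (-a) := by
    have : T ≤ ∫ t in Ioi X, t ^ (-a - 1) := by
      refine setIntegral_mono_on (intP ha0 hX0) (integrableOn_Ioi_rpow_of_lt (by linarith) hX0)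
        measurableSet_Ioi fun t ht => ?_
      have := Real.rpow_nonneg (hX0.trans ht).le (-a - 1)
      nlinarith [sawP_le t]
    rw [integral_Ioi_rpow_of_lt (by linarith) hX0, show -a - 1 + 1 = -a by ring,
      neg_div_neg_eq, le_div_iff₀ ha0] at this
    linarith
  have hPX : 0 ≤ sawP X * X ^ (-a) := mul_nonneg (sawP_nonneg X) (Real.rpow_nonneg hX0.le _)
  have hPX1 : sawP X * X ^ (-a) ≤ X ^ (-a) := by
    nlinarith [Real.rpow_nonneg hX0.le (-a), sawP_le X]
  have hfin : 1 / (2 * (1 - a)) - 1 / (2 - a)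
      + (sawP X * X ^ (-a) - -a * ∫ t in (1 : ℝ)..X, sawP t * t ^ (-a - 1))
      - (1 / (a - 2) + 1 / 2 + (a - 1) * a * J) / (a - 1) = sawP X * X ^ (-a) - a * T := by
    rw [hJs]
    generalize (∫ t in (1 : ℝ)..X, sawP t * t ^ (-a - 1)) = K
    have h1 : a - 1 ≠ 0 := by linarith
    have h2 : a - 2 ≠ 0 := by linarith
    rw [show 1 - a = -(a - 1) by ring, show 2 - a = -(a - 2) by ring]
    field_simp
    ring
  rw [hfin, abs_le]
  have := mul_nonneg ha0.le hT0
  constructor <;> linarith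
end

section
/- Let β be the multiplicative function with β(1) = 1, β(p) = 2/(p²−2), β(p²) = −p²/(p²−2) and β(p^k) = 0 for all primes p and k ≥ 3. Then h(d) = Σ_{d₁d₂ = d} β(d₁) for every integer d ≥ 1; in particular β is supported on cubefree numbers, and for every cubefree t written as t = ab² with a, b squarefree and gcd(a,b) = 1, one has |β(t)| ≪ d(a)/a², where d(a) is the number of divisors of a and the implied constant is absolute. -/
open scoped BigOperators

/-- The multiplicative function `h(d) = μ(d)²·∏_{p∣d}(1 − 2p^{-2})^{-1}`. -/
noncomputable def hfun (d : ℕ) : ℝ :=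
  ((ArithmeticFunction.moebius d : ℤ) : ℝ) ^ 2 *
    ∏ p ∈ d.primeFactors, (1 - 2 / (p : ℝ) ^ 2)⁻¹

/-- The multiplicative function `β` with `β(p) = 2/(p²−2)`, `β(p²) = −p²/(p²−2)`
and `β(p^k) = 0` for `k ≥ 3`. -/
noncomputable def betaF (t : ℕ) : ℝ :=
  ∏ p ∈ t.primeFactors,
    (if t.factorization p = 1 then 2 / ((p : ℝ) ^ 2 - 2)
     else if t.factorization p = 2 then -(p : ℝ) ^ 2 / ((p : ℝ) ^ 2 - 2) else 0)

lemma betaF_mul {m n : ℕ} (hmn : Nat.Coprime m n) :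
    betaF (m * n) = betaF m * betaF n := by
  unfold betaF
  rw [hmn.primeFactors_mul, Finset.prod_union hmn.disjoint_primeFactors]
  congr 1
  · refine Finset.prod_congr rfl fun p hp => ?_
    rw [Nat.factorization_eq_of_coprime_left hmn (by simpa using hp)]
  · refine Finset.prod_congr rfl fun p hp => ?_
    rw [Nat.factorization_eq_of_coprime_right hmn (by simpa using hp)]

lemma hfun_mul {m n : ℕ} (hmn : Nat.Coprime m n) :
    hfun (m * n) = hfun m * hfun n := by
  unfold hfun
  rw [hmn.primeFactors_mul, Finset.prod_union hmn.disjoint_primeFactors,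
    ArithmeticFunction.isMultiplicative_moebius.map_mul_of_coprime hmn]
  push_cast
  ring

noncomputable def hA : ArithmeticFunction ℝ := ⟨hfun, by simp [hfun]⟩

noncomputable def bA : ArithmeticFunction ℝ := ⟨fun t => if t = 0 then 0 else betaF t, by simp⟩

lemma hA_mult : hA.IsMultiplicative :=
  ⟨by simp [hA, hfun], fun h => hfun_mul h⟩

lemma bA_mult : bA.IsMultiplicative := by
  refine ⟨by simp [bA, betaF], fun {m n} h => ?_⟩
  show (if m * n = 0 then 0 else betaF (m * n)) =
    (if m = 0 then 0 else betaF m) * (if n = 0 then 0 else betaF n)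
  rcases eq_or_ne m 0 with rfl | hm
  · simp
  rcases eq_or_ne n 0 with rfl | hn
  · simp
  simp [hm, hn, betaF_mul h]

lemma betaF_pp {p : ℕ} (hp : p.Prime) (k : ℕ) : betaF (p ^ k) =
    if k = 0 then 1 else if k = 1 then 2 / ((p : ℝ) ^ 2 - 2)
     else if k = 2 then -(p : ℝ) ^ 2 / ((p : ℝ) ^ 2 - 2) else 0 := by
  rcases eq_or_ne k 0 with rfl | hk
  · simp [betaF]
  · simp only [betaF, Nat.primeFactors_prime_pow hk hp, Finset.prod_singleton,
      hp.factorization_pow, Finsupp.single_eq_same, if_neg hk]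

lemma sq_ge {p : ℕ} (hp : p.Prime) : (4 : ℝ) ≤ (p : ℝ) ^ 2 := by
  have : (2 : ℝ) ≤ p := by exact_mod_cast hp.two_le
  nlinarith

lemma sum_pp {p : ℕ} (hp : p.Prime) (k : ℕ) :
    ∑ i ∈ Finset.range (k + 3), betaF (p ^ i) = 0 := by
  have h4 := sq_ge hp
  induction k with
  | zero =>
    simp only [zero_add, Finset.sum_range_succ, Finset.sum_range_zero, betaF_pp hp]
    have : (p : ℝ) ^ 2 - 2 ≠ 0 := by linarith
    norm_num
    field_simp
    ring
  | succ k ih =>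
    rw [show k + 1 + 3 = (k + 3) + 1 by ring, Finset.sum_range_succ, ih, betaF_pp hp]
    simp

lemma part1 (d : ℕ) (hd : 1 ≤ d) : hfun d = ∑ d₁ ∈ d.divisors, betaF d₁ := by
  have key : hA = bA * ArithmeticFunction.zeta := by
    rw [ArithmeticFunction.IsMultiplicative.eq_iff_eq_on_prime_powers _ hA_mult _
      (bA_mult.mul ArithmeticFunction.isMultiplicative_zeta.natCast)]
    intro p k hp
    rw [ArithmeticFunction.coe_mul_zeta_apply, Nat.sum_divisors_prime_pow hp]
    have e : ∀ i, bA (p ^ i) = betaF (p ^ i) := fun i => by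
      show (if p ^ i = 0 then 0 else betaF (p ^ i)) = _
      rw [if_neg (pow_ne_zero _ hp.ne_zero)]
    simp only [e]
    show hfun (p ^ k) = _
    have h4 := sq_ge hp
    match k with
    | 0 => simp [hfun, betaF]
    | 1 =>
      simp only [Finset.sum_range_succ, Finset.sum_range_zero, betaF_pp hp]
      have : (p : ℝ) ^ 2 - 2 ≠ 0 := by linarith
      have : (p : ℝ) ≠ 0 := fun h => by rw [h] at h4; norm_num at h4
      have h3 : 1 - 2 / (p : ℝ) ^ 2 = ((p : ℝ) ^ 2 - 2) / (p : ℝ) ^ 2 := by field_simp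
      simp [hfun, hp.primeFactors, ArithmeticFunction.moebius_apply_prime hp]
      rw [h3]
      field_simp
      ring
    | k + 2 =>
      rw [sum_pp hp]
      have : ArithmeticFunction.moebius (p ^ (k + 2)) = 0 := by
        rw [ArithmeticFunction.moebius_apply_prime_pow hp (by omega)]
        simp
      simp [hfun, this]
  have := congrArg (fun f => f d) key
  simp only [ArithmeticFunction.coe_mul_zeta_apply] at this
  change hfun d = _ at this
  rw [this]
  refine Finset.sum_congr rfl fun i hi => ?_
  show (if i = 0 then 0 else betaF i) = _
  rw [if_neg (Nat.pos_of_mem_divisors hi).ne']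

lemma part2 (t : ℕ) (ht : 1 ≤ t) (h : ∃ p : ℕ, p.Prime ∧ p ^ 3 ∣ t) : betaF t = 0 := by
  obtain ⟨p, hp, hd⟩ := h
  have h3 := (hp.pow_dvd_iff_le_factorization (by omega)).1 hd
  refine Finset.prod_eq_zero (i := p) ?_ ?_
  · rw [← Nat.support_factorization, Finsupp.mem_support_iff]; omega
  · rw [if_neg (by omega), if_neg (by omega)]

lemma prod_bound (n : ℕ) : ∏ p ∈ n.primeFactors, (1 - 2 / (p : ℝ) ^ 2)⁻¹ ≤
    Real.exp (∑' k : ℕ, 4 * (1 / (k : ℝ) ^ 2)) := by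
  have hs : Summable fun k : ℕ => 4 * (1 / (k : ℝ) ^ 2) :=
    (Real.summable_one_div_nat_pow.2 (by norm_num)).mul_left 4
  calc _ ≤ ∏ p ∈ n.primeFactors, Real.exp (4 * (1 / (p : ℝ) ^ 2)) := by
        refine Finset.prod_le_prod (fun p hp => ?_) (fun p hp => ?_)
        · have h4 := sq_ge (Nat.prime_of_mem_primeFactors hp)
          rw [inv_nonneg, sub_nonneg, div_le_one (by linarith)]; linarith
        · have h4 := sq_ge (Nat.prime_of_mem_primeFactors hp)
          refine le_trans ?_ (Real.add_one_le_exp _)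
          have h3 : 1 - 2 / (p : ℝ) ^ 2 = ((p : ℝ) ^ 2 - 2) / (p : ℝ) ^ 2 := by
            have : (p : ℝ) ≠ 0 := fun h => by rw [h] at h4; norm_num at h4
            field_simp
          have h5 : 4 * (1 / (p : ℝ) ^ 2) + 1 = (4 + (p : ℝ) ^ 2) / (p : ℝ) ^ 2 := by
            have : (p : ℝ) ≠ 0 := fun h => by rw [h] at h4; norm_num at h4
            field_simp
          rw [h3, inv_div, h5, div_le_div_iff₀ (by linarith) (by linarith)]
          nlinarith
    _ = Real.exp (∑ p ∈ n.primeFactors, 4 * (1 / (p : ℝ) ^ 2)) := (Real.exp_sum _ _).symm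
    _ ≤ _ := Real.exp_le_exp.2 (hs.sum_le_tsum _ fun i _ => by positivity)

lemma prod_nonneg' (n : ℕ) : 0 ≤ ∏ p ∈ n.primeFactors, (1 - 2 / (p : ℝ) ^ 2)⁻¹ := by
  refine Finset.prod_nonneg fun p hp => ?_
  have h4 := sq_ge (Nat.prime_of_mem_primeFactors hp)
  rw [inv_nonneg, sub_nonneg, div_le_one (by linarith)]; linarith

lemma beta_sqf {a : ℕ} (ha : Squarefree a) : |betaF a| =
    (a.divisors.card : ℝ) / (a : ℝ) ^ 2 * ∏ p ∈ a.primeFactors, (1 - 2 / (p : ℝ) ^ 2)⁻¹ := by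
  have h1 : (a.divisors.card : ℝ) = ∏ p ∈ a.primeFactors, (2 : ℝ) := by
    rw [Nat.card_divisors ha.ne_zero]
    push_cast
    refine Finset.prod_congr rfl fun p hp => ?_
    rw [Nat.factorization_eq_one_of_squarefree ha (Nat.prime_of_mem_primeFactors hp)
      (Nat.dvd_of_mem_primeFactors hp)]
    norm_num
  have h2 : (a : ℝ) = ∏ p ∈ a.primeFactors, (p : ℝ) := by
    conv_lhs => rw [← Nat.prod_primeFactors_of_squarefree ha]
    push_cast; rfl
  rw [h1]
  conv_rhs => rw [h2]
  rw [← Finset.prod_pow, ← Finset.prod_div_distrib, ← Finset.prod_mul_distrib, betaF,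
    Finset.abs_prod]
  refine Finset.prod_congr rfl fun p hp => ?_
  have h4 := sq_ge (Nat.prime_of_mem_primeFactors hp)
  rw [Nat.factorization_eq_one_of_squarefree ha (Nat.prime_of_mem_primeFactors hp)
      (Nat.dvd_of_mem_primeFactors hp), if_pos rfl,
      abs_of_nonneg (div_nonneg (by norm_num) (by linarith))]
  have : (p : ℝ) ≠ 0 := fun h => by rw [h] at h4; norm_num at h4
  have : (p : ℝ) ^ 2 - 2 ≠ 0 := by linarith
  have h3 : 1 - 2 / (p : ℝ) ^ 2 = ((p : ℝ) ^ 2 - 2) / (p : ℝ) ^ 2 := by field_simp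
  rw [h3]
  field_simp

lemma beta_sq {b : ℕ} (hb : Squarefree b) : |betaF (b ^ 2)| =
    ∏ p ∈ b.primeFactors, (1 - 2 / (p : ℝ) ^ 2)⁻¹ := by
  rw [betaF, Finset.abs_prod, Nat.primeFactors_pow _ two_ne_zero]
  refine Finset.prod_congr rfl fun p hp => ?_
  have h4 := sq_ge (Nat.prime_of_mem_primeFactors hp)
  have hf : (b ^ 2).factorization p = 2 := by
    rw [Nat.factorization_pow, Finsupp.smul_apply,
      Nat.factorization_eq_one_of_squarefree hb (Nat.prime_of_mem_primeFactors hp)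
      (Nat.dvd_of_mem_primeFactors hp)]
    rfl
  have : (p : ℝ) ≠ 0 := fun h => by rw [h] at h4; norm_num at h4
  have h3 : 1 - 2 / (p : ℝ) ^ 2 = ((p : ℝ) ^ 2 - 2) / (p : ℝ) ^ 2 := by field_simp
  rw [hf, if_neg (by norm_num), if_pos rfl, neg_div, abs_neg,
    abs_of_nonneg (div_nonneg (by linarith) (by linarith)), h3, inv_div]

theorem statement6 :
    (∀ d : ℕ, 1 ≤ d → hfun d = ∑ d₁ ∈ d.divisors, betaF d₁) ∧
    (∀ t : ℕ, 1 ≤ t → (∃ p : ℕ, p.Prime ∧ p ^ 3 ∣ t) → betaF t = 0) ∧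
    (∃ A : ℝ, 0 < A ∧ ∀ a b : ℕ, Squarefree a → Squarefree b → Nat.Coprime a b →
      |betaF (a * b ^ 2)| ≤ A * (a.divisors.card : ℝ) / (a : ℝ) ^ 2) := by
  refine ⟨part1, part2, Real.exp (∑' k : ℕ, 4 * (1 / (k : ℝ) ^ 2)) *
    Real.exp (∑' k : ℕ, 4 * (1 / (k : ℝ) ^ 2)), by positivity, fun a b ha hb hab => ?_⟩
  rw [betaF_mul (hab.pow_right 2), abs_mul, beta_sqf ha, beta_sq hb, mul_assoc, mul_div_assoc,
    mul_comm]
  exact mul_le_mul_of_nonneg_right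
    (mul_le_mul (prod_bound a) (prod_bound b) (prod_nonneg' b) (Real.exp_pos _).le)
    (by positivity)
end

section
/- Uniformly for real Y ≥ 1 and nonzero integers r, one has Σ_{d ≥ 1, gcd(d,r)=1} ∫₀^{Y/d²} ψ(v) dv = (φ(r)/r)·(ζ(3/2)/(2π))·Y^{1/2} + O(d(r)·Y^{1/3}), where φ is Euler's totient, d(r) is the number of divisors of r, and the implied constant is absolute. -/
open scoped BigOperators

open MeasureTheory Set Filter Topology

noncomputable def GG (u : ℝ) : ℝ := (Int.fract u - Int.fract u ^ 2) / 2

lemma GG_cont : Continuous GG := by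
  have : ContinuousOn (fun x : ℝ => (x - x ^ 2) / 2) (Icc 0 1) := by fun_prop
  exact this.comp_fract'' (by norm_num)

lemma saw_bd (v : ℝ) : |saw v| ≤ 1 / 2 := by
  unfold saw
  have h1 := Int.floor_le v
  have h2 := Int.lt_floor_add_one v
  rw [abs_le]; constructor <;> linarith

lemma saw_ii (a b : ℝ) : IntervalIntegrable saw volume a b := by
  refine (intervalIntegrable_const (c := (1/2:ℝ))).mono_fun saw_meas.aestronglyMeasurable ?_
  refine Filter.Eventually.of_forall fun v => ?_
  show |saw v| ≤ |(1/2:ℝ)|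
  exact (saw_bd v).trans (le_abs_self _)

lemma GG_deriv (x : ℝ) (hx : x ∉ range ((↑) : ℤ → ℝ)) : HasDerivAt GG (saw x) x := by
  have h1 : (⌊x⌋ : ℝ) < x := lt_of_le_of_ne (Int.floor_le x) (fun h => hx ⟨_, h⟩)
  have h2 := Int.lt_floor_add_one x
  have hd : HasDerivAt (fun y : ℝ => ((y - ⌊x⌋) - (y - ⌊x⌋) ^ 2) / 2) (saw x) x := by
    have h0 : HasDerivAt (fun y : ℝ => y - ⌊x⌋) 1 x := (hasDerivAt_id x).sub_const _
    have := (h0.sub (h0.pow 2)).div_const 2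
    convert! this using 1
    unfold saw; push_cast; ring
  refine hd.congr_of_eventuallyEq ?_
  filter_upwards [Ioo_mem_nhds h1 h2] with y hy
  have : ⌊y⌋ = ⌊x⌋ := by
    rw [Int.floor_eq_iff]; exact ⟨hy.1.le, hy.2⟩
  unfold GG
  rw [Int.fract, this]

lemma int_saw (a b : ℝ) : ∫ v in a..b, saw v = GG b - GG a :=
  integral_eq_of_hasDerivAt_off_countable GG saw (countable_range _)
    GG_cont.continuousOn (fun x hx => GG_deriv x hx.2) (saw_ii a b)

lemma GG_zero : GG 0 = 0 := by simp [GG]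

lemma GG_lip (a b : ℝ) : |GG b - GG a| ≤ 1 / 2 * |b - a| := by
  rw [← int_saw]
  have := intervalIntegral.norm_integral_le_of_norm_le_const (a := a) (b := b) (f := saw) (C := 1/2)
    (fun x _ => by rw [Real.norm_eq_abs]; exact saw_bd x)
  simpa using this

lemma GG_nonneg (u : ℝ) : 0 ≤ GG u := by
  unfold GG
  have h1 := Int.fract_nonneg u
  have h2 := (Int.fract_lt_one u).le
  nlinarith

lemma GG_le (u : ℝ) : GG u ≤ 1 / 8 := by
  unfold GG
  nlinarith [sq_nonneg (Int.fract u - 1/2)]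

lemma GG_le_lin (u : ℝ) (hu : 0 ≤ u) : GG u ≤ u / 2 := by
  have := GG_lip 0 u
  rw [GG_zero, sub_zero, sub_zero, abs_of_nonneg hu] at this
  have := le_abs_self (GG u)
  linarith

lemma GG_fourier (u : ℝ) :
    HasSum (fun n : ℕ => (1 - Real.cos (2 * Real.pi * n * u)) / (2 * Real.pi ^ 2 * n ^ 2)) (GG u) := by
  have hx : Int.fract u ∈ Icc (0:ℝ) 1 := ⟨Int.fract_nonneg u, (Int.fract_lt_one u).le⟩
  have h1 := hasSum_one_div_nat_pow_mul_cos one_ne_zero hx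
  have h0 := hasSum_zeta_two
  have h2 := (h0.sub h1).mul_left (1 / (2 * Real.pi ^ 2))
  have hpi := Real.pi_ne_zero
  convert! h2 using 1
  · funext n
    have : Real.cos (2 * Real.pi * n * Int.fract u) = Real.cos (2 * Real.pi * n * u) := by
      have := Real.cos_sub_int_mul_two_pi (2 * Real.pi * n * u) (n * ⌊u⌋)
      rw [← this]
      congr 1
      rw [Int.fract]; push_cast; ring
    rw [this]
    rcases Nat.eq_zero_or_pos n with h | h
    · simp [h]
    · have : (n:ℝ) ≠ 0 := by positivity
      rw [mul_one]
      field_simp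
  · have := bernoulliFun_two (Int.fract u)
    unfold bernoulliFun at this
    rw [mul_one, this]
    unfold GG
    norm_num [Nat.factorial]
    field_simp
    ring


lemma J_bd (ε w : ℝ) (h0 : 0 ≤ ε) (h1 : ε ≤ 1) (hw : 0 < w) :
    ‖(1 - Complex.exp (-((ε : ℂ) + Complex.I) * (w : ℂ) ^ 2)) / (w : ℂ) ^ 2‖ ≤ 8 * (1 + w ^ 2)⁻¹ := by
  set b : ℂ := (ε : ℂ) + Complex.I with hb
  have hb2 : ‖b‖ ≤ 2 := by
    calc ‖b‖ ≤ ‖(ε : ℂ)‖ + ‖Complex.I‖ := norm_add_le _ _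
      _ ≤ 2 := by
        rw [Complex.norm_real, Complex.norm_I, Real.norm_eq_abs, abs_of_nonneg h0]; linarith
  have hb1 : 1 ≤ ‖b‖ := by
    have := Complex.abs_im_le_norm b
    simpa [hb] using this
  have hw2 : 0 < w ^ 2 := by positivity
  have hz : ‖-b * (w : ℂ) ^ 2‖ = ‖b‖ * w ^ 2 := by
    rw [norm_mul, norm_neg, norm_pow, Complex.norm_real, Real.norm_eq_abs, sq_abs]
  rw [norm_div, norm_pow, Complex.norm_real, Real.norm_eq_abs, sq_abs, div_le_iff₀ hw2, norm_sub_rev,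
    ← div_eq_mul_inv, div_mul_eq_mul_div, le_div_iff₀ (by positivity)]
  by_cases hc : ‖-b * (w : ℂ) ^ 2‖ ≤ 1
  · have := Complex.norm_exp_sub_one_le hc
    rw [hz] at this hc
    have h3 : w ^ 2 ≤ 1 := by nlinarith
    have h4 : ‖Complex.exp (-b * (w : ℂ) ^ 2) - 1‖ ≤ 4 * w ^ 2 := by nlinarith
    nlinarith
  · rw [hz] at hc
    push Not at hc
    have h3 : 1 ≤ 2 * w ^ 2 := by nlinarith
    have h4 : ‖Complex.exp (-b * (w : ℂ) ^ 2) - 1‖ ≤ 2 := by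
      refine (norm_sub_le _ _).trans ?_
      have : ‖Complex.exp (-b * (w : ℂ) ^ 2)‖ ≤ 1 := by
        rw [Complex.norm_exp, Real.exp_le_one_iff]
        have : (-b * (w : ℂ) ^ 2).re = -(ε * w ^ 2) := by
          rw [← Complex.ofReal_pow, Complex.re_mul_ofReal]; simp [hb]
        rw [this]
        have : 0 ≤ ε * w ^ 2 := by positivity
        linarith
      rw [norm_one]; linarith
    nlinarith

lemma J_meas (b : ℂ) : Measurable (fun w : ℝ => (1 - Complex.exp (-b * (w : ℂ) ^ 2)) / (w : ℂ) ^ 2) := by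
  fun_prop

lemma bd_int : IntegrableOn (fun w : ℝ => 8 * (1 + w ^ 2)⁻¹) (Ioi 0) :=
  (integrable_inv_one_add_sq.const_mul 8).integrableOn

lemma J_int (ε : ℝ) (h0 : 0 ≤ ε) (h1 : ε ≤ 1) :
    IntegrableOn (fun w : ℝ => (1 - Complex.exp (-((ε : ℂ) + Complex.I) * (w : ℂ) ^ 2)) / (w : ℂ) ^ 2)
      (Ioi 0) := by
  refine Integrable.mono' bd_int (J_meas _).aestronglyMeasurable ?_
  filter_upwards [ae_restrict_mem measurableSet_Ioi] with w hw
  exact J_bd ε w h0 h1 hw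

lemma J_val (ε : ℝ) (h0 : 0 < ε) (h1 : ε ≤ 1) :
    ∫ w : ℝ in Ioi 0, (1 - Complex.exp (-((ε : ℂ) + Complex.I) * (w : ℂ) ^ 2)) / (w : ℂ) ^ 2
      = ((ε : ℂ) + Complex.I) * (Real.pi / ((ε : ℂ) + Complex.I)) ^ (1 / 2 : ℂ) := by
  have hJ := J_int ε h0.le h1
  have hbd := fun w hw => J_bd ε w h0.le h1 hw
  set b : ℂ := (ε : ℂ) + Complex.I with hb
  have hbre : 0 < b.re := by simpa [hb] using h0
  have hg := (integrable_cexp_neg_mul_sq hbre).integrableOn (s := Ioi 0)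
  have hgv := integral_gaussian_complex_Ioi hbre
  set φ : ℝ → ℂ := fun w => -((1 - Complex.exp (-b * (w : ℂ) ^ 2)) / (w : ℂ)) with hφ
  have hφn : ∀ w : ℝ, 0 < w → ‖φ w‖ ≤ 8 * w * (1 + w ^ 2)⁻¹ := by
    intro w hw
    have := hbd w hw
    have e : φ w = -(w * ((1 - Complex.exp (-b * (w : ℂ) ^ 2)) / (w : ℂ) ^ 2)) := by
      have : (w : ℂ) ≠ 0 := by exact_mod_cast hw.ne'
      simp only [hφ]
      field_simp
    rw [e, norm_neg, norm_mul, Complex.norm_real, Real.norm_eq_abs, abs_of_pos hw]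
    nlinarith
  have hint : IntegrableOn (fun w : ℝ => (1 - Complex.exp (-b * (w : ℂ) ^ 2)) / (w : ℂ) ^ 2
      - 2 * b * Complex.exp (-b * (w : ℂ) ^ 2)) (Ioi 0) := hJ.sub (hg.const_mul _)
  have key : ∫ w : ℝ in Ioi 0, ((1 - Complex.exp (-b * (w : ℂ) ^ 2)) / (w : ℂ) ^ 2
      - 2 * b * Complex.exp (-b * (w : ℂ) ^ 2)) = 0 - φ 0 := by
    apply integral_Ioi_of_hasDerivAt_of_tendsto (f := φ) _ _ hint
    · rw [tendsto_zero_iff_norm_tendsto_zero]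
      refine tendsto_of_tendsto_of_tendsto_of_le_of_le' tendsto_const_nhds
        (h := fun w : ℝ => 8 * w⁻¹) ?_ (Eventually.of_forall fun _ => norm_nonneg _) ?_
      · simpa using tendsto_inv_atTop_zero.const_mul (8:ℝ)
      · filter_upwards [eventually_gt_atTop 0] with w hw
        refine (hφn w hw).trans ?_
        rw [← div_eq_mul_inv, ← div_eq_mul_inv, div_le_div_iff₀ (by positivity) hw]
        nlinarith
    · have : φ 0 = 0 := by simp [hφ]
      rw [ContinuousWithinAt, this, tendsto_zero_iff_norm_tendsto_zero]
      refine tendsto_of_tendsto_of_tendsto_of_le_of_le' tendsto_const_nhds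
        (h := fun w : ℝ => 8 * w) ?_ (Eventually.of_forall fun _ => norm_nonneg _) ?_
      · have : Tendsto (fun w : ℝ => 8 * w) (𝓝 0) (𝓝 (8 * 0)) := by
          exact (continuous_const.mul continuous_id).tendsto 0
        rw [mul_zero] at this
        exact this.mono_left nhdsWithin_le_nhds
      · filter_upwards [self_mem_nhdsWithin] with w hw
        rcases (mem_Ici.1 hw).eq_or_lt with h | h
        · rw [← h]; simp [this]
        · refine (hφn w h).trans ?_
          have : (1 + w ^ 2)⁻¹ ≤ 1 := inv_le_one_of_one_le₀ (by nlinarith)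
          nlinarith
    · intro w hw
      have hw0 : (w : ℂ) ≠ 0 := by exact_mod_cast (mem_Ioi.1 hw).ne'
      have h1 : HasDerivAt (fun z : ℂ => -((1 - Complex.exp (-b * z ^ 2)) / z))
          ((1 - Complex.exp (-b * (w : ℂ) ^ 2)) / (w : ℂ) ^ 2
            - 2 * b * Complex.exp (-b * (w : ℂ) ^ 2)) (w : ℂ) := by
        have h2 : HasDerivAt (fun z : ℂ => -b * z ^ 2) (-b * (2 * w)) (w : ℂ) := by
          simpa using ((hasDerivAt_id (w : ℂ)).pow 2).const_mul (-b)
        have h3 := ((h2.cexp.const_sub 1).div (hasDerivAt_id (w : ℂ)) hw0).neg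
        convert! h3 using 1
        simp only [id]
        field_simp
        ring
      exact h1.comp_ofReal
  rw [integral_sub hJ (hg.const_mul _), integral_const_mul, hgv] at key
  have : φ 0 = 0 := by simp [hφ]
  rw [this, sub_zero, sub_eq_zero] at key
  rw [key]; ring

lemma J_lim : ∫ w : ℝ in Ioi 0, (1 - Complex.exp (-(((0:ℝ) : ℂ) + Complex.I) * (w : ℂ) ^ 2)) / (w : ℂ) ^ 2
      = (((0:ℝ) : ℂ) + Complex.I) * (Real.pi / (((0:ℝ) : ℂ) + Complex.I)) ^ (1 / 2 : ℂ) := by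
  have hu : Tendsto (fun n : ℕ => (1 / ((n : ℝ) + 1))) atTop (𝓝 0) :=
    tendsto_one_div_add_atTop_nhds_zero_nat
  have hp : ∀ n : ℕ, 0 < 1 / ((n : ℝ) + 1) := fun n => by positivity
  have hl : ∀ n : ℕ, 1 / ((n : ℝ) + 1) ≤ 1 := fun n => by
    rw [div_le_one (by positivity)]; linarith [(Nat.cast_nonneg n : (0:ℝ) ≤ n)]
  have h1 := tendsto_integral_of_dominated_convergence (μ := volume.restrict (Ioi (0:ℝ)))
    (F := fun (n : ℕ) (w : ℝ) => (1 - Complex.exp (-(((1 / ((n : ℝ) + 1) : ℝ) : ℂ) + Complex.I) * (w : ℂ) ^ 2)) / (w : ℂ) ^ 2)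
    (f := fun (w : ℝ) => (1 - Complex.exp (-(((0:ℝ) : ℂ) + Complex.I) * (w : ℂ) ^ 2)) / (w : ℂ) ^ 2)
    (fun w : ℝ => 8 * (1 + w ^ 2)⁻¹) (fun n => (J_meas _).aestronglyMeasurable) bd_int
    (fun n => by
      filter_upwards [ae_restrict_mem measurableSet_Ioi] with w hw
      exact J_bd _ w (hp n).le (hl n) hw)
    (by
      refine Eventually.of_forall fun w => ?_
      have : Continuous (fun e : ℝ => (1 - Complex.exp (-((e : ℂ) + Complex.I) * (w : ℂ) ^ 2)) / (w : ℂ) ^ 2) := by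
        fun_prop
      exact (this.tendsto 0).comp hu)
  refine tendsto_nhds_unique h1 ?_
  simp_rw [fun n => J_val _ (hp n) (hl n)]
  have hc : ContinuousAt (fun e : ℝ => ((e : ℂ) + Complex.I) * (Real.pi / ((e : ℂ) + Complex.I)) ^ (1 / 2 : ℂ)) 0 := by
    have hI : ((0:ℝ) : ℂ) + Complex.I ≠ 0 := by simp
    have h2 : ContinuousAt (fun e : ℝ => ((e : ℂ) + Complex.I)) 0 := by fun_prop
    refine h2.mul (ContinuousAt.cpow (continuousAt_const.div h2 hI) continuousAt_const ?_)
    right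
    simp [Real.pi_ne_zero]
  exact hc.tendsto.comp hu

lemma J_cos_int : IntegrableOn (fun w : ℝ => (1 - Real.cos (w ^ 2)) / w ^ 2) (Ioi 0) ∧
    ∫ w : ℝ in Ioi 0, (1 - Real.cos (w ^ 2)) / w ^ 2 = √(Real.pi / 2) := by
  have hi := J_int 0 le_rfl zero_le_one
  have hv := J_lim
  have hre : ∀ w : ℝ, ((1 - Complex.exp (-(((0:ℝ) : ℂ) + Complex.I) * (w : ℂ) ^ 2)) / (w : ℂ) ^ 2).re
      = (1 - Real.cos (w ^ 2)) / w ^ 2 := by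
    intro w
    rw [← Complex.ofReal_pow, Complex.div_ofReal_re, Complex.sub_re, Complex.one_re, Complex.exp_re]
    simp [← Complex.ofReal_pow]
  have h1 := hi.re
  have h2 := integral_re hi
  simp only [RCLike.re_eq_complex_re] at h1 h2
  simp_rw [hre] at h1 h2
  refine ⟨h1, ?_⟩
  rw [h2, hv]
  have e1 : (((0:ℝ) : ℂ) + Complex.I) * (Real.pi / (((0:ℝ) : ℂ) + Complex.I)) ^ (1 / 2 : ℂ) =
      ((√(Real.pi / 2) : ℝ) : ℂ) * (1 + Complex.I) := by
    have e2 : (Real.pi / (((0:ℝ) : ℂ) + Complex.I)) = (((√(Real.pi / 2) : ℝ) : ℂ) * (1 - Complex.I)) ^ 2 := by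
      rw [mul_pow, ← Complex.ofReal_pow, Real.sq_sqrt (by positivity)]
      have : (1 - Complex.I) ^ 2 = - 2 * Complex.I := by
        ring_nf; rw [Complex.I_sq]; ring
      rw [this]; push_cast
      rw [zero_add, Complex.div_I]; ring
    have hpos : 0 < √(Real.pi / 2) := Real.sqrt_pos.2 (by positivity)
    have hz : (((√(Real.pi / 2) : ℝ) : ℂ) * (1 - Complex.I)).arg = - (Real.pi / 4) := by
      rw [Complex.arg_real_mul _ hpos]
      have : (1 - Complex.I) = ((√2 : ℝ) : ℂ) * (Complex.cos ((-(Real.pi / 4) : ℝ) : ℂ) + Complex.sin ((-(Real.pi / 4) : ℝ) : ℂ) * Complex.I) := by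
        rw [← Complex.ofReal_cos, ← Complex.ofReal_sin, Real.cos_neg, Real.sin_neg, Real.cos_pi_div_four, Real.sin_pi_div_four]
        have : (√2 : ℝ) * (√2 / 2) = 1 := by
          rw [← mul_div_assoc, Real.mul_self_sqrt (by norm_num)]; norm_num
        have h' : ((√2 : ℝ) : ℂ) * ((√2 / 2 : ℝ) : ℂ) = 1 := by exact_mod_cast this
        rw [Complex.ofReal_neg]
        linear_combination (-(1 - Complex.I)) * h'
      rw [this]
      apply Complex.arg_mul_cos_add_sin_mul_I (by positivity)
      constructor <;> linarith [Real.pi_pos]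
    rw [e2]
    have := Complex.pow_cpow_nat_inv (x := ((√(Real.pi / 2) : ℝ) : ℂ) * (1 - Complex.I)) (n := 2) two_ne_zero
      (by rw [hz]; push_cast; linarith [Real.pi_pos]) (by rw [hz]; push_cast; linarith [Real.pi_pos])
    push_cast at this ⊢
    rw [one_div, this]
    ring_nf; rw [Complex.I_sq]; ring
  rw [e1]
  simp

lemma J_scale (a : ℝ) (ha : 0 < a) : IntegrableOn (fun w : ℝ => (1 - Real.cos (a * w ^ 2)) / w ^ 2) (Ioi 0) ∧
    ∫ w : ℝ in Ioi 0, (1 - Real.cos (a * w ^ 2)) / w ^ 2 = √a * √(Real.pi / 2) := by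
  obtain ⟨hi, hv⟩ := J_cos_int
  have hs : 0 < √a := Real.sqrt_pos.2 ha
  have hsq : √a ^ 2 = a := Real.sq_sqrt ha.le
  have e : (fun w : ℝ => (1 - Real.cos (a * w ^ 2)) / w ^ 2) =
      fun w : ℝ => a * (fun w : ℝ => (1 - Real.cos (w ^ 2)) / w ^ 2) (√a * w) := by
    funext w
    simp only [mul_pow, hsq]
    by_cases hw : w = 0
    · simp [hw]
    · field_simp
  rw [e]
  constructor
  · apply Integrable.const_mul
    have := (integrableOn_Ioi_comp_mul_left_iff (fun w : ℝ => (1 - Real.cos (w ^ 2)) / w ^ 2) 0 hs)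
    rw [mul_zero] at this
    exact this.2 hi
  · rw [integral_const_mul, integral_comp_mul_left_Ioi (fun w : ℝ => (1 - Real.cos (w ^ 2)) / w ^ 2) _ hs, mul_zero, hv, smul_eq_mul]
    nth_rewrite 1 [← hsq]
    field_simp

lemma zeta_sum : HasSum (fun n : ℕ => √(n : ℝ) / (n : ℝ) ^ 2) (riemannZeta (3 / 2)).re := by
  have h32 : (1:ℝ) < ((3 / 2 : ℂ)).re := by norm_num
  have hs := (Complex.summable_one_div_nat_cpow (p := (3/2:ℂ))).2 h32
  have h := hs.hasSum
  rw [← zeta_eq_tsum_one_div_nat_cpow h32] at h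
  have h2 := Complex.hasSum_re h
  convert! h2 using 1
  funext n
  have e : (1 / (n : ℂ) ^ (3 / 2 : ℂ)) = ((1 / (n : ℝ) ^ (3 / 2 : ℝ) : ℝ) : ℂ) := by
    push_cast
    rw [Complex.ofReal_cpow (Nat.cast_nonneg n)]
    push_cast; rfl
  rw [e, Complex.ofReal_re]
  rcases Nat.eq_zero_or_pos n with h | h
  · subst h; norm_num
  · have hn : (0:ℝ) < n := by exact_mod_cast h
    rw [Real.sqrt_eq_rpow, div_eq_div_iff (by positivity) (by positivity), one_mul, ← Real.rpow_add hn,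
      ← Real.rpow_natCast]
    norm_num

lemma GG_int_w (X : ℝ) (hX : 0 < X) :
    ∫ w : ℝ in Ioi 0, GG (X * w ^ 2) / w ^ 2 = (riemannZeta (3 / 2)).re / (2 * Real.pi) * √X := by
  have hpi := Real.pi_pos
  have hterm : ∀ n : ℕ, IntegrableOn (fun w : ℝ =>
      (1 - Real.cos (2 * Real.pi * n * (X * w ^ 2))) / (2 * Real.pi ^ 2 * n ^ 2) / w ^ 2) (Ioi 0) ∧
      ∫ w : ℝ in Ioi 0, (1 - Real.cos (2 * Real.pi * n * (X * w ^ 2))) / (2 * Real.pi ^ 2 * n ^ 2) / w ^ 2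
        = √X / (2 * Real.pi) * (√(n : ℝ) / (n : ℝ) ^ 2) := by
    intro n
    rcases Nat.eq_zero_or_pos n with h | h
    · subst h; simp
    · have hn : (0:ℝ) < n := by exact_mod_cast h
      obtain ⟨hi, hv⟩ := J_scale (2 * Real.pi * n * X) (by positivity)
      have e : (fun w : ℝ => (1 - Real.cos (2 * Real.pi * n * (X * w ^ 2))) / (2 * Real.pi ^ 2 * n ^ 2) / w ^ 2)
        = fun w : ℝ => (2 * Real.pi ^ 2 * n ^ 2)⁻¹ * ((1 - Real.cos (2 * Real.pi * n * X * w ^ 2)) / w ^ 2) := by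
        funext w
        rw [mul_assoc (2 * Real.pi * n) X]
        rw [div_div, mul_comm (2 * Real.pi ^ 2 * (n:ℝ) ^ 2), ← div_div, div_eq_inv_mul]
      rw [e]
      refine ⟨hi.const_mul _, ?_⟩
      rw [integral_const_mul, hv, ← Real.sqrt_mul (by positivity)]
      have : 2 * Real.pi * n * X * (Real.pi / 2) = Real.pi ^ 2 * (X * n) := by ring
      rw [this, Real.sqrt_mul (by positivity), Real.sqrt_sq hpi.le, Real.sqrt_mul hX.le]
      field_simp
  have hsum := zeta_sum.mul_left (√X / (2 * Real.pi))
  have h := hasSum_integral_of_summable_integral_norm (fun n => (hterm n).1) (by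
    refine hsum.summable.congr fun n => ?_
    rw [← (hterm n).2]
    refine integral_congr_ae (Eventually.of_forall fun w => ?_)
    have : 0 ≤ (1 - Real.cos (2 * Real.pi * n * (X * w ^ 2))) / (2 * Real.pi ^ 2 * n ^ 2) / w ^ 2 := by
      have := Real.cos_le_one (2 * Real.pi * n * (X * w ^ 2))
      have : 0 ≤ 1 - Real.cos (2 * Real.pi * n * (X * w ^ 2)) := by linarith
      positivity
    simp only [Real.norm_eq_abs]
    exact (abs_of_nonneg this).symm)
  simp_rw [fun n => (hterm n).2] at h
  have h3 := h.unique hsum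
  have e2 : ∀ w : ℝ, ∑' n : ℕ, (1 - Real.cos (2 * Real.pi * n * (X * w ^ 2))) / (2 * Real.pi ^ 2 * n ^ 2) / w ^ 2
      = GG (X * w ^ 2) / w ^ 2 := fun w => ((GG_fourier (X * w ^ 2)).div_const _).tsum_eq
  simp_rw [e2] at h3
  rw [h3]; ring

lemma GG_int_t (X : ℝ) (hX : 0 < X) :
    ∫ t : ℝ in Ioi 0, GG (X / t ^ 2) = (riemannZeta (3 / 2)).re / (2 * Real.pi) * √X := by
  rw [← GG_int_w X hX, ← integral_comp_rpow_Ioi (fun t => GG (X / t ^ 2)) (p := -1) (by norm_num)]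
  refine setIntegral_congr_fun measurableSet_Ioi fun w hw => ?_
  have hw : 0 < w := hw
  have e1 : w ^ (-1 - 1 : ℝ) = (w ^ 2)⁻¹ := by
    rw [show (-1 - 1 : ℝ) = -((2:ℕ):ℝ) by norm_num, Real.rpow_neg hw.le, Real.rpow_natCast]
  simp only [e1, Real.rpow_neg_one, smul_eq_mul, abs_neg, abs_one, one_mul]
  rw [inv_pow, div_inv_eq_mul, inv_mul_eq_div]

lemma GG_intOn (X : ℝ) (hX : 0 ≤ X) : IntegrableOn (fun t : ℝ => GG (X / t ^ 2)) (Ioi 0) := by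
  have hm : Measurable (fun t : ℝ => GG (X / t ^ 2)) := by
    have := GG_cont.measurable
    fun_prop
  refine Integrable.mono' ((integrable_inv_one_add_sq.const_mul (1 / 8 + X / 2)).integrableOn)
    hm.aestronglyMeasurable ?_
  filter_upwards [ae_restrict_mem measurableSet_Ioi] with t ht
  have ht : 0 < t := ht
  rw [Real.norm_eq_abs, abs_of_nonneg (GG_nonneg _), ← div_eq_mul_inv, le_div_iff₀ (by positivity)]
  have h1 := GG_le (X / t ^ 2)
  have h2 := GG_le_lin (X / t ^ 2) (by positivity)
  have h3 : X / t ^ 2 / 2 * t ^ 2 = X / 2 := by field_simp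
  have h4 := mul_le_mul_of_nonneg_right h2 (sq_nonneg t)
  nlinarith

lemma GG_ii (X : ℝ) (hX : 0 ≤ X) (a b : ℝ) (ha : 0 ≤ a) (hb : 0 ≤ b) :
    IntervalIntegrable (fun t : ℝ => GG (X / t ^ 2)) volume a b := by
  rw [intervalIntegrable_iff]
  refine (GG_intOn X hX).mono_set fun x hx => ?_
  exact lt_of_le_of_lt (le_min ha hb) hx.1

lemma GG_summable (X : ℝ) (hX : 0 ≤ X) : Summable (fun m : ℕ => GG (X / (m : ℝ) ^ 2)) := by
  have h := (Real.summable_one_div_nat_pow (p := 2)).2 (by norm_num)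
  refine Summable.of_nonneg_of_le (fun m => GG_nonneg _) (fun m => ?_) (h.mul_left (X / 2))
  refine (GG_le_lin _ (by positivity)).trans (le_of_eq ?_)
  ring

lemma GG_finite (X : ℝ) (hX : 0 ≤ X) (N : ℕ) (hN : 1 ≤ N) (M : ℕ) (hM : N ≤ M) :
    |∑ m ∈ Finset.range (M + 1), GG (X / (m : ℝ) ^ 2) - ∫ t in (0:ℝ)..M, GG (X / t ^ 2)|
      ≤ N / 8 + (X / 2 / N ^ 2 - X / 2 / M ^ 2) := by
  induction M, hM using Nat.le_induction with
  | base =>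
    rw [sub_self, add_zero]
    have s1 : 0 ≤ ∑ m ∈ Finset.range (N + 1), GG (X / (m : ℝ) ^ 2) :=
      Finset.sum_nonneg fun _ _ => GG_nonneg _
    have s2 : ∑ m ∈ Finset.range (N + 1), GG (X / (m : ℝ) ^ 2) ≤ N / 8 := by
      rw [Finset.sum_range_succ']
      have : ∑ m ∈ Finset.range N, GG (X / ((m + 1 : ℕ) : ℝ) ^ 2) ≤ ∑ m ∈ Finset.range N, (1 / 8 : ℝ) :=
        Finset.sum_le_sum fun _ _ => GG_le _
      simp [GG_zero] at this ⊢
      linarith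
    have i1 : 0 ≤ ∫ t in (0:ℝ)..N, GG (X / t ^ 2) :=
      intervalIntegral.integral_nonneg (Nat.cast_nonneg N) fun _ _ => GG_nonneg _
    have i2 : ∫ t in (0:ℝ)..N, GG (X / t ^ 2) ≤ N / 8 := by
      have := intervalIntegral.integral_mono_on (Nat.cast_nonneg N)
        (GG_ii X hX 0 N le_rfl (Nat.cast_nonneg N)) (intervalIntegrable_const (c := (1/8:ℝ)))
        (fun t _ => GG_le (X / t ^ 2))
      simp at this
      linarith
    rw [abs_le]; constructor <;> linarith
  | succ M hM ih =>
    have hM0 : (0:ℝ) < M := by exact_mod_cast (by omega : 0 < M)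
    have hM1 : (0:ℝ) ≤ ((M + 1 : ℕ) : ℝ) := Nat.cast_nonneg _
    rw [Finset.sum_range_succ, ← intervalIntegral.integral_add_adjacent_intervals
      (GG_ii X hX 0 M le_rfl hM0.le) (GG_ii X hX M ((M + 1 : ℕ) : ℝ) hM0.le hM1)]
    have step : |GG (X / ((M + 1 : ℕ) : ℝ) ^ 2) - ∫ t in (M:ℝ)..((M + 1 : ℕ) : ℝ), GG (X / t ^ 2)|
        ≤ X / 2 / M ^ 2 - X / 2 / ((M + 1 : ℕ) : ℝ) ^ 2 := by
      have e : GG (X / ((M + 1 : ℕ) : ℝ) ^ 2) = ∫ t in (M:ℝ)..((M + 1 : ℕ) : ℝ), GG (X / ((M + 1 : ℕ) : ℝ) ^ 2) := by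
        rw [intervalIntegral.integral_const]; push_cast; simp
      rw [e, ← intervalIntegral.integral_sub intervalIntegrable_const (GG_ii X hX _ _ hM0.le hM1)]
      have := intervalIntegral.norm_integral_le_of_norm_le_const (a := (M:ℝ)) (b := ((M + 1 : ℕ) : ℝ))
        (f := fun t => GG (X / ((M + 1 : ℕ) : ℝ) ^ 2) - GG (X / t ^ 2))
        (C := X / 2 / M ^ 2 - X / 2 / ((M + 1 : ℕ) : ℝ) ^ 2) (fun t ht => by
          rw [uIoc_of_le (by push_cast; linarith)] at ht
          rw [Real.norm_eq_abs]
          refine (GG_lip _ _).trans ?_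
          have ht0 : 0 < t := hM0.trans ht.1
          have a1 : X / ((M + 1 : ℕ) : ℝ) ^ 2 ≤ X / t ^ 2 := by
            have := ht.2
            gcongr
          have a2 : X / t ^ 2 ≤ X / (M : ℝ) ^ 2 := by
            have := ht.1.le
            gcongr
          rw [abs_sub_comm, abs_of_nonneg (by linarith), div_right_comm, div_right_comm X 2]
          linarith)
      refine this.trans (le_of_eq ?_)
      push_cast; simp
    calc _ = |(∑ m ∈ Finset.range (M + 1), GG (X / (m : ℝ) ^ 2) - ∫ t in (0:ℝ)..M, GG (X / t ^ 2)) +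
          (GG (X / ((M + 1 : ℕ) : ℝ) ^ 2) - ∫ t in (M:ℝ)..((M + 1 : ℕ) : ℝ), GG (X / t ^ 2))| := by
            congr 1; ring
      _ ≤ _ := (abs_add_le _ _).trans (add_le_add ih step)
      _ = _ := by ring

lemma GG_tsum (X : ℝ) (hX : 0 < X) (N : ℕ) (hN : 1 ≤ N) :
    |∑' m : ℕ, GG (X / (m : ℝ) ^ 2) - (riemannZeta (3 / 2)).re / (2 * Real.pi) * √X|
      ≤ N / 8 + X / 2 / N ^ 2 := by
  rw [← GG_int_t X hX]
  have h1 := ((GG_summable X hX.le).hasSum.tendsto_sum_nat).comp (tendsto_add_atTop_nat 1)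
  have h2 := intervalIntegral_tendsto_integral_Ioi 0 (GG_intOn X hX.le) tendsto_natCast_atTop_atTop
  refine le_of_tendsto (h1.sub h2).abs ?_
  filter_upwards [eventually_ge_atTop N] with M hM
  refine (GG_finite X hX.le N hN M hM).trans ?_
  have : 0 ≤ X / 2 / (M:ℝ) ^ 2 := by positivity
  linarith

open ArithmeticFunction in
lemma moeb_ind (n d : ℕ) (hn : n ≠ 0) :
    ∑ e ∈ n.divisors, (if e ∣ d then (moebius e : ℝ) else 0) = if Nat.Coprime d n then 1 else 0 := by
  have h1 : n.divisors.filter (· ∣ d) = (Nat.gcd d n).divisors := by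
    ext e
    have : Nat.gcd d n ≠ 0 := Nat.gcd_ne_zero_right hn
    simp [hn, this, Nat.dvd_gcd_iff, and_comm]
  rw [← Finset.sum_filter, h1]
  have h2 : ∑ e ∈ (Nat.gcd d n).divisors, moebius e = if Nat.gcd d n = 1 then 1 else 0 := by
    rw [← coe_mul_zeta_apply, moebius_mul_coe_zeta, one_apply]
  have h3 := congrArg (Int.cast : ℤ → ℝ) h2
  push_cast at h3
  rw [h3]

open ArithmeticFunction in
lemma moeb_tot (n : ℕ) (hn : n ≠ 0) :
    ∑ e ∈ n.divisors, (moebius e : ℝ) * (1 / e) = (Nat.totient n : ℝ) / n := by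
  have h := (sum_eq_iff_sum_mul_moebius_eq (R := ℝ) (f := fun m => (Nat.totient m : ℝ)) (g := fun m => (m : ℝ))).1
    (fun m _ => by exact_mod_cast Nat.sum_totient m) n (Nat.pos_of_ne_zero hn)
  rw [← h, Nat.sum_divisorsAntidiagonal (fun a b => (moebius a : ℝ) * (b : ℝ)), Finset.sum_div]
  refine Finset.sum_congr rfl fun e he => ?_
  have he' := Nat.dvd_of_mem_divisors he
  have he0 : (e : ℝ) ≠ 0 := by exact_mod_cast (Nat.pos_of_mem_divisors he).ne'
  have hn0 : (n : ℝ) ≠ 0 := by exact_mod_cast hn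
  rw [Nat.cast_div he' he0]
  field_simp

open ArithmeticFunction in
lemma moeb_tsum (Y : ℝ) (hY : 0 ≤ Y) (n : ℕ) (hn : n ≠ 0) :
    (∑' d : ℕ, if 1 ≤ d ∧ Nat.Coprime d n then ∫ v in (0 : ℝ)..(Y / (d : ℝ) ^ 2), saw v else 0)
      = ∑ e ∈ n.divisors, (moebius e : ℝ) * ∑' m : ℕ, GG (Y / (e : ℝ) ^ 2 / (m : ℝ) ^ 2) := by
  have h1 : ∀ d : ℕ, (if 1 ≤ d ∧ Nat.Coprime d n then ∫ v in (0 : ℝ)..(Y / (d : ℝ) ^ 2), saw v else 0)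
      = ∑ e ∈ n.divisors, (moebius e : ℝ) * (if e ∣ d then GG (Y / (d : ℝ) ^ 2) else 0) := by
    intro d
    have h2 : ∑ e ∈ n.divisors, (moebius e : ℝ) * (if e ∣ d then GG (Y / (d : ℝ) ^ 2) else 0)
        = (∑ e ∈ n.divisors, (if e ∣ d then (moebius e : ℝ) else 0)) * GG (Y / (d : ℝ) ^ 2) := by
      rw [Finset.sum_mul]
      refine Finset.sum_congr rfl fun e _ => ?_
      split_ifs <;> simp
    rw [h2, moeb_ind n d hn, int_saw, GG_zero, sub_zero]
    rcases Nat.eq_zero_or_pos d with h | h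
    · subst h; simp [GG_zero]
    · by_cases hc : Nat.Coprime d n
      · simp [hc, Nat.one_le_iff_ne_zero, h.ne']
      · simp [hc]
  simp_rw [h1]
  have hs : ∀ e : ℕ, Summable (fun d : ℕ => if e ∣ d then GG (Y / (d : ℝ) ^ 2) else 0) := by
    intro e
    refine Summable.of_nonneg_of_le (fun d => ?_) (fun d => ?_) (GG_summable Y hY)
    · split_ifs; exacts [GG_nonneg _, le_rfl]
    · split_ifs; exacts [le_rfl, GG_nonneg _]
  rw [Summable.tsum_finsetSum (fun e _ => (hs e).mul_left _)]
  refine Finset.sum_congr rfl fun e he => ?_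
  have he0 := (Nat.pos_of_mem_divisors he)
  rw [tsum_mul_left]
  congr 1
  have hinj : Function.Injective (fun m : ℕ => e * m) := fun a b hab => Nat.eq_of_mul_eq_mul_left he0 hab
  rw [← hinj.tsum_eq (f := fun d : ℕ => if e ∣ d then GG (Y / (d : ℝ) ^ 2) else 0)]
  · refine tsum_congr fun m => ?_
    simp only [dvd_mul_right, if_true]
    push_cast
    rw [mul_pow, div_div]
  · intro d hd
    by_contra hc
    apply hd
    have : ¬ e ∣ d := fun ⟨m, hm⟩ => hc ⟨m, hm.symm⟩
    simp [this]

theorem statement7 :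
    ∃ A : ℝ, 0 < A ∧ ∀ (Y : ℝ) (r : ℤ), 1 ≤ Y → r ≠ 0 →
      |(∑' d : ℕ, if 1 ≤ d ∧ Nat.Coprime d r.natAbs then
            ∫ v in (0 : ℝ)..(Y / (d : ℝ) ^ 2), saw v
          else 0)
          - (Nat.totient r.natAbs : ℝ) / (r.natAbs : ℝ) *
              ((riemannZeta (3 / 2)).re / (2 * Real.pi)) * Y ^ ((1 : ℝ)/2)|
        ≤ A * (r.natAbs.divisors.card : ℝ) * Y ^ ((1 : ℝ)/3) := by
  refine ⟨1, one_pos, fun Y r hY hr => ?_⟩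
  have hn : r.natAbs ≠ 0 := Int.natAbs_ne_zero.2 hr
  generalize r.natAbs = n at hn
  have hY0 : 0 < Y := by linarith
  rw [moeb_tsum Y hY0.le n hn, ← moeb_tot n hn, ← Real.sqrt_eq_rpow, Finset.sum_mul, Finset.sum_mul,
    ← Finset.sum_sub_distrib]
  refine (Finset.abs_sum_le_sum_abs _ _).trans ?_
  rw [one_mul, ← nsmul_eq_mul]
  refine Finset.sum_le_card_nsmul _ _ _ fun e he => ?_
  have he0 : (1:ℝ) ≤ e := by exact_mod_cast (Nat.pos_of_mem_divisors he)
  have hep : (0:ℝ) < e := by linarith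
  set Z : ℝ := Y ^ ((1:ℝ)/3) with hZ
  have hZ1 : 1 ≤ Z := Real.one_le_rpow hY (by norm_num)
  have hZ3 : Z ^ 3 = Y := by
    rw [hZ, ← Real.rpow_natCast, ← Real.rpow_mul hY0.le]; norm_num
  set N := ⌈Z⌉₊ with hNdef
  have hN1 : Z ≤ N := Nat.le_ceil Z
  have hN2 : (N:ℝ) < Z + 1 := Nat.ceil_lt_add_one (by linarith)
  have hN : 1 ≤ N := by
    have : (1:ℝ) ≤ N := hZ1.trans hN1
    exact_mod_cast this
  have hb := GG_tsum (Y / (e:ℝ) ^ 2) (by positivity) N hN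
  have hsq : √(Y / (e:ℝ) ^ 2) = 1 / e * √Y := by
    rw [Real.sqrt_div hY0.le, Real.sqrt_sq hep.le]; ring
  rw [hsq] at hb
  have hmu : |(ArithmeticFunction.moebius e : ℝ)| ≤ 1 := by
    exact_mod_cast ArithmeticFunction.abs_moebius_le_one (n := e)
  have heq : (ArithmeticFunction.moebius e : ℝ) * ∑' m : ℕ, GG (Y / (e : ℝ) ^ 2 / (m : ℝ) ^ 2) -
      (ArithmeticFunction.moebius e : ℝ) * (1 / e) * ((riemannZeta (3 / 2)).re / (2 * Real.pi)) * √Y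
      = (ArithmeticFunction.moebius e : ℝ) * (∑' m : ℕ, GG (Y / (e : ℝ) ^ 2 / (m : ℝ) ^ 2) -
        (riemannZeta (3 / 2)).re / (2 * Real.pi) * (1 / e * √Y)) := by ring
  rw [heq, abs_mul]
  refine (mul_le_of_le_one_left (abs_nonneg _) hmu).trans (hb.trans ?_)
  have hX : Y / (e:ℝ) ^ 2 / 2 / (N:ℝ) ^ 2 ≤ Z / 2 := by
    have h1 : Y / (e:ℝ) ^ 2 ≤ Y := div_le_self hY0.le (one_le_pow₀ he0)
    rw [div_le_iff₀ (by positivity)]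
    have h2 : Z ^ 2 ≤ (N:ℝ) ^ 2 := by gcongr
    nlinarith
  linarith
end

section
/- Let m be a squarefree integer. Then, with the sums running over ordered pairs (ρ,σ) of positive integers whose product ρσ divides m², one has: (i) Σ_{ρσ ∣ m²} κ(ρ)μ(σ)/(ρσ) = ∏_{p∣m}(p²−1)/p²; (ii) Σ_{ρσ ∣ m²} κ(ρ)μ(σ) = ∏_{p∣m}(p²−p)/(p²−1); (iii) Σ_{ρσ ∣ m²} κ(ρ)μ(σ)·(ρσ)^{1/2} = ∏_{p∣m}(p² − p^{3/2} + p − 1)/(p²−1). -/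
open scoped BigOperators

/-- The multiplicative function `κ` with `κ(p) = (p²−p−1)/(p²−1)`,
`κ(p²) = (p²−p)/(p²−1)` and `κ(p^α) = 0` for `α ≥ 3`. -/
noncomputable def kappa (n : ℕ) : ℝ :=
  ∏ p ∈ n.primeFactors,
    (if n.factorization p = 1 then ((p : ℝ) ^ 2 - p - 1) / ((p : ℝ) ^ 2 - 1)
     else if n.factorization p = 2 then ((p : ℝ) ^ 2 - p) / ((p : ℝ) ^ 2 - 1) else 0)

open ArithmeticFunction in
/-- kappa as an arithmetic function. -/
noncomputable def kapAF : ArithmeticFunction ℝ := ⟨fun n => if n = 0 then 0 else kappa n, by simp⟩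

theorem kapAF_apply {n : ℕ} (h : n ≠ 0) : kapAF n = kappa n := by
  simp [kapAF, h]

theorem kappa_mul {a b : ℕ} (ha : a ≠ 0) (hb : b ≠ 0) (h : a.Coprime b) :
    kappa (a * b) = kappa a * kappa b := by
  unfold kappa
  rw [h.primeFactors_mul, Finset.prod_union h.disjoint_primeFactors]
  congr 1
  · refine Finset.prod_congr rfl fun p hp => ?_
    rw [Nat.factorization_eq_of_coprime_left h (by simpa using hp)]
  · refine Finset.prod_congr rfl fun p hp => ?_
    rw [Nat.factorization_eq_of_coprime_right h (by simpa using hp)]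

theorem kapAF_mult : kapAF.IsMultiplicative := by
  rw [ArithmeticFunction.IsMultiplicative.iff_ne_zero]
  refine ⟨by simp [kapAF, kappa], fun {a b} ha hb h => ?_⟩
  rw [kapAF_apply ha, kapAF_apply hb, kapAF_apply (mul_ne_zero ha hb), kappa_mul ha hb h]

theorem kappa_one : kappa 1 = 1 := by simp [kappa]

theorem kappa_p {p : ℕ} (hp : p.Prime) : kappa p = ((p : ℝ) ^ 2 - p - 1) / ((p : ℝ) ^ 2 - 1) := by
  simp [kappa, hp.primeFactors, hp.factorization_self]

theorem kappa_p2 {p : ℕ} (hp : p.Prime) : kappa (p ^ 2) = ((p : ℝ) ^ 2 - p) / ((p : ℝ) ^ 2 - 1) := by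
  simp [kappa, Nat.primeFactors_prime_pow two_ne_zero hp, hp.factorization_self]

theorem sum_pairs (N : ℕ) (hN : N ≠ 0) (h : ℕ → ℕ → ℝ) :
    (∑ ρ ∈ N.divisors, ∑ σ ∈ N.divisors, (if ρ * σ ∣ N then h ρ σ else 0))
      = ∑ d ∈ N.divisors, ∑ x ∈ d.divisorsAntidiagonal, h x.1 x.2 := by
  rw [← Finset.sum_product', ← Finset.sum_filter,
    ← Finset.sum_fiberwise_of_maps_to (t := N.divisors) (g := fun x : ℕ × ℕ => x.1 * x.2)
      (by intro x hx; simp at hx ⊢; tauto)]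
  refine Finset.sum_congr rfl fun d hd => Finset.sum_congr ?_ fun _ _ => rfl
  have hd' := Nat.dvd_of_mem_divisors hd
  have hd0 : d ≠ 0 := fun h0 => hN (by simpa [h0] using hd')
  ext ⟨a, b⟩
  simp only [Finset.mem_filter, Finset.mem_product, Nat.mem_divisors, Nat.mem_divisorsAntidiagonal]
  constructor
  · rintro ⟨_, h⟩; exact ⟨h, hd0⟩
  · rintro ⟨h, _⟩
    subst h
    exact ⟨⟨⟨⟨(Dvd.intro _ rfl).trans hd', hN⟩, ⟨(Dvd.intro_left _ rfl).trans hd', hN⟩⟩, hd'⟩, rfl⟩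

theorem main_sum (n : ℕ) (hn : Squarefree n) (w : ℕ → ℝ) (w1 : w 1 = 1)
    (wm : ∀ a b, w (a * b) = w a * w b) :
    (∑ ρ ∈ (n ^ 2).divisors, ∑ σ ∈ (n ^ 2).divisors,
      (if ρ * σ ∣ n ^ 2 then
        kappa ρ * ((ArithmeticFunction.moebius σ : ℤ) : ℝ) * w (ρ * σ) else 0))
      = ∏ p ∈ n.primeFactors,
        (1 - (p : ℝ) / ((p : ℝ) ^ 2 - 1) * w p + 1 / ((p : ℝ) ^ 2 - 1) * w p ^ 2) := by
  have hN : n ^ 2 ≠ 0 := pow_ne_zero _ hn.ne_zero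
  let W : ArithmeticFunction ℝ := ⟨fun n => if n = 0 then 0 else w n, by simp⟩
  have hW : ∀ {n : ℕ}, n ≠ 0 → W n = w n := fun {n} h => by simp [W, h]
  have hWm : W.IsMultiplicative := by
    rw [ArithmeticFunction.IsMultiplicative.iff_ne_zero]
    refine ⟨by simp [W, w1], fun {a b} ha hb h => ?_⟩
    rw [hW ha, hW hb, hW (mul_ne_zero ha hb), wm]
  let G : ArithmeticFunction ℝ := (kapAF * (ArithmeticFunction.moebius : ArithmeticFunction ℝ)).pmul W
  let F : ArithmeticFunction ℝ := G * (ArithmeticFunction.zeta : ArithmeticFunction ℝ)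
  have hG : G.IsMultiplicative :=
    (kapAF_mult.mul ArithmeticFunction.isMultiplicative_moebius.intCast).pmul hWm
  have hF : F.IsMultiplicative := hG.mul ArithmeticFunction.isMultiplicative_zeta.natCast
  have hGv : ∀ d : ℕ, d ≠ 0 → G d = ∑ x ∈ d.divisorsAntidiagonal,
      kappa x.1 * ((ArithmeticFunction.moebius x.2 : ℤ) : ℝ) * w (x.1 * x.2) := by
    intro d hd
    simp only [G, ArithmeticFunction.pmul_apply, ArithmeticFunction.mul_apply, Finset.sum_mul]
    refine Finset.sum_congr rfl fun x hx => ?_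
    rw [Nat.mem_divisorsAntidiagonal] at hx
    have h1 : x.1 ≠ 0 := by rintro h; rw [h] at hx; simp at hx; exact hd hx.1.symm
    rw [hW hd, kapAF_apply h1, hx.1, ArithmeticFunction.intCoe_apply]
  have hFv : ∀ d : ℕ, F d = ∑ x ∈ d.divisors, G x := fun d => by
    simp only [F, ArithmeticFunction.coe_mul_zeta_apply]
  rw [sum_pairs _ hN (fun ρ σ => kappa ρ * ((ArithmeticFunction.moebius σ : ℤ) : ℝ) * w (ρ * σ))]
  trans F (n ^ 2)
  · rw [hFv]
    refine Finset.sum_congr rfl fun d hd => ?_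
    rw [hGv d (Nat.pos_of_mem_divisors hd).ne']
  rw [hF.multiplicative_factorization F hN, Finsupp.prod, Nat.support_factorization,
    Nat.primeFactors_pow _ two_ne_zero]
  refine Finset.prod_congr rfl fun p hp => ?_
  have hpp := Nat.prime_of_mem_primeFactors hp
  have hf : n.factorization p = 1 := by
    have h1 := hn.natFactorization_le_one p
    have h2 := hpp.factorization_pos_of_dvd hn.ne_zero (Nat.dvd_of_mem_primeFactors hp)
    omega
  have hp1 : (p : ℝ) ^ 2 - 1 ≠ 0 := by
    have : (2 : ℝ) ≤ p := by exact_mod_cast hpp.two_le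
    nlinarith
  have hmu2 : ArithmeticFunction.moebius (p ^ 2) = 0 := by
    rw [ArithmeticFunction.moebius_apply_prime_pow hpp two_ne_zero]; simp
  have hmu1 := ArithmeticFunction.moebius_apply_prime hpp
  rw [Nat.factorization_pow, Finsupp.smul_apply, hf, hFv, smul_eq_mul, mul_one,
    Nat.sum_divisors_prime_pow hpp]
  have g0 : G 1 = 1 := hG.map_one
  have hp0 := hpp.ne_zero
  have g1 : G p = (kappa p - 1) * w p := by
    rw [hGv p hp0, Nat.sum_divisorsAntidiagonal (fun a b => kappa a * ((ArithmeticFunction.moebius b : ℤ) : ℝ) * w (a * b)), hpp.sum_divisors]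
    simp [Nat.div_self hpp.pos, hmu1, kappa_one]
    ring
  have g2 : G (p ^ 2) = (kappa (p ^ 2) - kappa p) * w p ^ 2 := by
    have e : p ^ 2 / p = p := by rw [pow_two, Nat.mul_div_cancel _ hpp.pos]
    have e2 : p ^ 2 / p ^ 2 = 1 := Nat.div_self (pow_pos hpp.pos 2)
    rw [hGv _ (pow_ne_zero _ hp0), Nat.sum_divisorsAntidiagonal (fun a b => kappa a * ((ArithmeticFunction.moebius b : ℤ) : ℝ) * w (a * b)), Nat.sum_divisors_prime_pow hpp]
    simp only [Finset.sum_range_succ, Finset.sum_range_zero, pow_zero, pow_one, Nat.div_one, e, e2,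
      hmu1, hmu2, ArithmeticFunction.moebius_apply_one, mul_one, wm]
    have e3 : w (p ^ 2) = w p * w p := by rw [pow_two, wm]
    rw [e3, w1]
    push_cast
    ring
  simp only [Finset.sum_range_succ, Finset.sum_range_zero, pow_zero, pow_one]
  rw [g0, g1, g2, kappa_p hpp, kappa_p2 hpp]
  field_simp
  ring

theorem statement9 (m : ℤ) (hm : Squarefree m) :
    (∑ ρ ∈ (m.natAbs ^ 2).divisors, ∑ σ ∈ (m.natAbs ^ 2).divisors,
        (if ρ * σ ∣ m.natAbs ^ 2 then
          kappa ρ * ((ArithmeticFunction.moebius σ : ℤ) : ℝ) / ((ρ : ℝ) * σ) else 0))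
      = (∏ p ∈ m.natAbs.primeFactors, (((p : ℝ) ^ 2 - 1) / (p : ℝ) ^ 2)) ∧
    (∑ ρ ∈ (m.natAbs ^ 2).divisors, ∑ σ ∈ (m.natAbs ^ 2).divisors,
        (if ρ * σ ∣ m.natAbs ^ 2 then
          kappa ρ * ((ArithmeticFunction.moebius σ : ℤ) : ℝ) else 0))
      = (∏ p ∈ m.natAbs.primeFactors, (((p : ℝ) ^ 2 - p) / ((p : ℝ) ^ 2 - 1))) ∧
    (∑ ρ ∈ (m.natAbs ^ 2).divisors, ∑ σ ∈ (m.natAbs ^ 2).divisors,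
        (if ρ * σ ∣ m.natAbs ^ 2 then
          kappa ρ * ((ArithmeticFunction.moebius σ : ℤ) : ℝ) *
            ((ρ : ℝ) * σ) ^ ((1 : ℝ)/2) else 0))
      = (∏ p ∈ m.natAbs.primeFactors,
          (((p : ℝ) ^ 2 - (p : ℝ) ^ ((3 : ℝ)/2) + p - 1) / ((p : ℝ) ^ 2 - 1))) := by
  have hn : Squarefree m.natAbs := Int.squarefree_natAbs.mpr hm
  have key : ∀ p ∈ m.natAbs.primeFactors, (0 : ℝ) < p ∧ (p : ℝ) ^ 2 - 1 ≠ 0 := by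
    intro p hp
    have : (2 : ℝ) ≤ p := by exact_mod_cast (Nat.prime_of_mem_primeFactors hp).two_le
    exact ⟨by linarith, by nlinarith⟩
  refine ⟨?_, ?_, ?_⟩
  · have h := main_sum _ hn (fun n => ((n : ℝ))⁻¹) (by simp) (fun a b => by push_cast; rw [mul_inv])
    simp only [Nat.cast_mul, ← div_eq_mul_inv] at h
    rw [h]
    refine Finset.prod_congr rfl fun p hp => ?_
    obtain ⟨h0, h1⟩ := key p hp
    field_simp
    ring
  · have h := main_sum _ hn (fun _ => 1) rfl (fun a b => by simp)
    simp only [mul_one] at h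
    rw [h]
    refine Finset.prod_congr rfl fun p hp => ?_
    obtain ⟨h0, h1⟩ := key p hp
    field_simp
    ring
  · have h := main_sum _ hn (fun n => (n : ℝ) ^ ((1 : ℝ) / 2)) (by simp)
      (fun a b => by push_cast; rw [Real.mul_rpow (by positivity) (by positivity)])
    simp only [Nat.cast_mul] at h
    rw [h]
    refine Finset.prod_congr rfl fun p hp => ?_
    obtain ⟨h0, h1⟩ := key p hp
    have e1 : ((p : ℝ) ^ ((1 : ℝ) / 2)) ^ 2 = p := by
      rw [← Real.sqrt_eq_rpow, Real.sq_sqrt h0.le]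
    have e2 : (p : ℝ) ^ ((3 : ℝ) / 2) = p * (p : ℝ) ^ ((1 : ℝ) / 2) := by
      rw [show (3 : ℝ) / 2 = 1 + 1 / 2 by norm_num, Real.rpow_add h0, Real.rpow_one]
    rw [e1, e2]
    generalize (p : ℝ) ^ ((1 : ℝ) / 2) = s
    field_simp
    ring
end

section
/- Let Z ≥ 1 be real and u ≥ 1 an integer. Then: (i) Σ_{1 ≤ λ ≤ Z} gcd(u,λ)/λ ≪ d(u)·log(2Z); (ii) Σ_{1 ≤ λ,μ ≤ Z} gcd(u,λ,μ)/(λμ) ≪ d(u)·(log(2Z))²; (iii) Σ_{1 ≤ λ,μ,ν ≤ Z} gcd(u,λ,μ,ν)/(λμν) ≪ (log(2Z))³; where d(u) is the number of divisors of u, the sums run over integer tuples, and all implied constants are absolute. -/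
open scoped BigOperators

noncomputable def aux15 (d l : ℕ) : ℝ := if d ∣ l then 1 / (l : ℝ) else 0

lemma aux15_nonneg (d l : ℕ) : 0 ≤ aux15 d l := by
  unfold aux15; split_ifs <;> positivity

lemma aux15_sum (N d : ℕ) (hd : 0 < d) :
    ∑ l ∈ Finset.Icc 1 N, aux15 d l ≤ (∑ l ∈ Finset.Icc 1 N, 1 / (l : ℝ)) / d := by
  unfold aux15
  rw [← Finset.sum_filter, Finset.sum_div]
  have hsub : (Finset.Icc 1 N).filter (fun l => d ∣ l) ⊆ (Finset.Icc 1 N).image (fun k => d * k) := by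
    intro l hl
    simp only [Finset.mem_filter, Finset.mem_Icc, Finset.mem_image] at hl ⊢
    obtain ⟨⟨h1, h2⟩, k, rfl⟩ := hl
    refine ⟨k, ⟨Nat.pos_of_ne_zero ?_, ?_⟩, rfl⟩
    · rintro rfl; simp at h1
    · nlinarith
  refine (Finset.sum_le_sum_of_subset_of_nonneg hsub (fun i _ _ => by positivity)).trans ?_
  rw [Finset.sum_image (fun a _ b _ h => Nat.eq_of_mul_eq_mul_left hd h)]
  refine Finset.sum_le_sum fun k _ => le_of_eq ?_
  push_cast
  rw [div_div, mul_comm]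

lemma gcd15 (u x : ℕ) (hu : 1 ≤ u) :
    (Nat.gcd u x : ℝ) ≤ ∑ d ∈ u.divisors, (d : ℝ) * (if d ∣ x then 1 else 0) := by
  have hm : Nat.gcd u x ∈ u.divisors :=
    Nat.mem_divisors.2 ⟨Nat.gcd_dvd_left _ _, by omega⟩
  refine le_trans ?_ (Finset.single_le_sum (f := fun d : ℕ => (d : ℝ) * (if d ∣ x then 1 else 0))
    (fun i _ => by positivity) hm)
  simp [Nat.gcd_dvd_right]

lemma harm15 (Z : ℝ) (hZ : 1 ≤ Z) :
    ∑ l ∈ Finset.Icc 1 ⌊Z⌋₊, 1 / (l : ℝ) ≤ 2 * Real.log (2 * Z) := by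
  have h := harmonic_floor_le_one_add_log Z hZ
  have h2 : ((harmonic ⌊Z⌋₊ : ℚ) : ℝ) = ∑ l ∈ Finset.Icc 1 ⌊Z⌋₊, 1 / (l : ℝ) := by
    rw [harmonic_eq_sum_Icc]; push_cast; simp
  rw [h2] at h
  rw [Real.log_mul (by norm_num) (by linarith)]
  have := Real.log_two_gt_d9
  have := Real.log_nonneg hZ
  linarith

lemma zeta15 (s : Finset ℕ) : ∑ d ∈ s, 1 / (d : ℝ) ^ 2 ≤ 2 := by
  refine (sum_le_hasSum s (fun i _ => by positivity) hasSum_zeta_two).trans ?_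
  have := Real.pi_lt_d2
  have := Real.pi_pos
  nlinarith

theorem statement15 :
    ∃ A : ℝ, 0 < A ∧ ∀ (Z : ℝ) (u : ℕ), 1 ≤ Z → 1 ≤ u →
      (∑ l ∈ Finset.Icc 1 ⌊Z⌋₊, (Nat.gcd u l : ℝ) / l
          ≤ A * (u.divisors.card : ℝ) * Real.log (2 * Z)) ∧
      (∑ l ∈ Finset.Icc 1 ⌊Z⌋₊, ∑ m ∈ Finset.Icc 1 ⌊Z⌋₊,
            (Nat.gcd u (Nat.gcd l m) : ℝ) / ((l : ℝ) * m)
          ≤ A * (u.divisors.card : ℝ) * (Real.log (2 * Z)) ^ 2) ∧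
      (∑ l ∈ Finset.Icc 1 ⌊Z⌋₊, ∑ m ∈ Finset.Icc 1 ⌊Z⌋₊, ∑ n ∈ Finset.Icc 1 ⌊Z⌋₊,
            (Nat.gcd u (Nat.gcd l (Nat.gcd m n)) : ℝ) / ((l : ℝ) * m * n)
          ≤ A * (Real.log (2 * Z)) ^ 3) := by
  refine ⟨16, by norm_num, fun Z u hZ hu => ?_⟩
  have hH := harm15 Z hZ
  set H := ∑ l ∈ Finset.Icc 1 ⌊Z⌋₊, 1 / (l : ℝ) with hHdef
  have hH0 : 0 ≤ H := Finset.sum_nonneg fun i _ => by positivity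
  set L := Real.log (2 * Z)
  have hL0 : 0 ≤ L := by linarith
  have hS : ∀ d ∈ u.divisors, ∑ l ∈ Finset.Icc 1 ⌊Z⌋₊, aux15 d l ≤ 2 * L / d := fun d hd =>
    (aux15_sum _ d (Nat.pos_of_mem_divisors hd)).trans (by gcongr)
  have hS0 : ∀ d, 0 ≤ ∑ l ∈ Finset.Icc 1 ⌊Z⌋₊, aux15 d l := fun d =>
    Finset.sum_nonneg fun i _ => aux15_nonneg d i
  have hd1 : ∀ d ∈ u.divisors, (1 : ℝ) ≤ d := fun d hd => by
    exact_mod_cast Nat.pos_of_mem_divisors hd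
  refine ⟨?_, ?_, ?_⟩
  · calc _ ≤ ∑ l ∈ Finset.Icc 1 ⌊Z⌋₊, ∑ d ∈ u.divisors, (d : ℝ) * aux15 d l := by
          refine Finset.sum_le_sum fun l _ => ?_
          refine (div_le_div_of_nonneg_right (gcd15 u l hu) (by positivity)).trans (le_of_eq ?_)
          rw [Finset.sum_div]
          refine Finset.sum_congr rfl fun d _ => ?_
          unfold aux15; split_ifs <;> simp [div_eq_mul_inv]
      _ = ∑ d ∈ u.divisors, (d : ℝ) * ∑ l ∈ Finset.Icc 1 ⌊Z⌋₊, aux15 d l := by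
          rw [Finset.sum_comm]; simp_rw [Finset.mul_sum]
      _ ≤ ∑ d ∈ u.divisors, 2 * L := by
          refine Finset.sum_le_sum fun d hd => ?_
          have := hd1 d hd
          calc _ ≤ (d : ℝ) * (2 * L / d) := by gcongr; exact hS d hd
            _ = 2 * L := by field_simp
      _ ≤ _ := by
          rw [Finset.sum_const, nsmul_eq_mul]
          have : 0 ≤ (u.divisors.card : ℝ) * L := by positivity
          linarith
  · calc _ ≤ ∑ l ∈ Finset.Icc 1 ⌊Z⌋₊, ∑ m ∈ Finset.Icc 1 ⌊Z⌋₊, ∑ d ∈ u.divisors,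
            (d : ℝ) * (aux15 d l * aux15 d m) := by
          refine Finset.sum_le_sum fun l _ => Finset.sum_le_sum fun m _ => ?_
          refine (div_le_div_of_nonneg_right (gcd15 u _ hu) (by positivity)).trans (le_of_eq ?_)
          rw [Finset.sum_div]
          refine Finset.sum_congr rfl fun d _ => ?_
          unfold aux15
          by_cases h1 : d ∣ l <;> by_cases h2 : d ∣ m <;>
            simp [h1, h2, Nat.dvd_gcd_iff, div_eq_mul_inv, mul_comm]
      _ = ∑ d ∈ u.divisors, (d : ℝ) * (∑ l ∈ Finset.Icc 1 ⌊Z⌋₊, aux15 d l) ^ 2 := by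
          have e : ∀ d : ℕ, (d : ℝ) * (∑ l ∈ Finset.Icc 1 ⌊Z⌋₊, aux15 d l) ^ 2 =
            ∑ l ∈ Finset.Icc 1 ⌊Z⌋₊, ∑ m ∈ Finset.Icc 1 ⌊Z⌋₊,
              (d : ℝ) * (aux15 d l * aux15 d m) := by
            intro d
            simp_rw [← Finset.mul_sum, ← Finset.sum_mul]
            ring
          simp_rw [e]
          rw [Finset.sum_comm (s := u.divisors)]
          refine Finset.sum_congr rfl fun l _ => ?_
          rw [Finset.sum_comm (s := u.divisors)]
      _ ≤ ∑ d ∈ u.divisors, 4 * L ^ 2 := by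
          refine Finset.sum_le_sum fun d hd => ?_
          have := hd1 d hd
          calc _ ≤ (d : ℝ) * (2 * L / d) ^ 2 := by gcongr; exacts [hS0 d, hS d hd]
            _ = 4 * L ^ 2 / d := by field_simp; ring
            _ ≤ _ := div_le_self (by positivity) this
      _ ≤ _ := by
          rw [Finset.sum_const, nsmul_eq_mul]
          have : 0 ≤ (u.divisors.card : ℝ) * L ^ 2 := by positivity
          linarith
  · calc _ ≤ ∑ l ∈ Finset.Icc 1 ⌊Z⌋₊, ∑ m ∈ Finset.Icc 1 ⌊Z⌋₊, ∑ n ∈ Finset.Icc 1 ⌊Z⌋₊,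
            ∑ d ∈ u.divisors, (d : ℝ) * (aux15 d l * (aux15 d m * aux15 d n)) := by
          refine Finset.sum_le_sum fun l _ => Finset.sum_le_sum fun m _ =>
            Finset.sum_le_sum fun n _ => ?_
          refine (div_le_div_of_nonneg_right (gcd15 u _ hu) (by positivity)).trans (le_of_eq ?_)
          rw [Finset.sum_div]
          refine Finset.sum_congr rfl fun d _ => ?_
          unfold aux15
          by_cases h1 : d ∣ l <;> by_cases h2 : d ∣ m <;> by_cases h3 : d ∣ n <;>
            simp [h1, h2, h3, Nat.dvd_gcd_iff, div_eq_mul_inv, mul_comm, mul_left_comm, mul_assoc]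
      _ = ∑ d ∈ u.divisors, (d : ℝ) * (∑ l ∈ Finset.Icc 1 ⌊Z⌋₊, aux15 d l) ^ 3 := by
          have e : ∀ d : ℕ, (d : ℝ) * (∑ l ∈ Finset.Icc 1 ⌊Z⌋₊, aux15 d l) ^ 3 =
            ∑ l ∈ Finset.Icc 1 ⌊Z⌋₊, ∑ m ∈ Finset.Icc 1 ⌊Z⌋₊, ∑ n ∈ Finset.Icc 1 ⌊Z⌋₊,
              (d : ℝ) * (aux15 d l * (aux15 d m * aux15 d n)) := by
            intro d
            simp_rw [← Finset.mul_sum, ← Finset.sum_mul]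
            ring
          simp_rw [e]
          rw [Finset.sum_comm (s := u.divisors)]
          refine Finset.sum_congr rfl fun l _ => ?_
          rw [Finset.sum_comm (s := u.divisors)]
          refine Finset.sum_congr rfl fun m _ => ?_
          rw [Finset.sum_comm (s := u.divisors)]
      _ ≤ ∑ d ∈ u.divisors, 8 * L ^ 3 * (1 / (d : ℝ) ^ 2) := by
          refine Finset.sum_le_sum fun d hd => ?_
          have := hd1 d hd
          calc _ ≤ (d : ℝ) * (2 * L / d) ^ 3 := by gcongr; exacts [hS0 d, hS d hd]
            _ = _ := by field_simp; ring
      _ ≤ 8 * L ^ 3 * 2 := by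
          rw [← Finset.mul_sum]
          exact mul_le_mul_of_nonneg_left (zeta15 _) (by positivity)
      _ = _ := by ring
end
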